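/- arXiv:1412.3259 — 2 statements merged into one kernel-verified Lean document; each statement's English description precedes it below -/
import Mathlib

section
/- (Key Lemma.) Let Γ be a discrete subgroup of SL(2,ℝ), let g₀ ∈ SL(2,ℝ), and let 0 < a ≤ b. Suppose there are a sequence (γ_n) in Γ and a sequence of real numbers (t_n) with t_n → +∞ such that, setting z_n = (g₀·d(t_n))·i ∈ ℍ, one has dist(z_n, γ_n·z_n) = ℓ(γ_n) and a ≤ ℓ(γ_n) ≤ b for every n (that is, z_n lies on the axis of a hyperbolic element of Γ whose translation length lies in [a,b]; equivalently, the projection to Γ\ℍ of the geodesic ray t ↦ (g₀·d(t))·i meets at time t_n a closed geodesic of length between a and b). Then there exists t₀ > 0 such that g₀·d(t₀) lies in the closure, in SL(2,ℝ), of the set {γ·g₀·u(s) : γ ∈ Γ, s ∈ ℝ}; equivalently, in the quotient Γ\SL(2,ℝ) the point g_{t₀}(u) lies in the closure of the horocycle orbit of u = Γg₀. -/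
open Matrix Real
open scoped MatrixGroups UpperHalfPlane

/-- The diagonal matrix `d(t)` generating the geodesic flow. -/
noncomputable def dMat (t : ℝ) : SL(2, ℝ) :=
  ⟨!![Real.exp (t / 2), 0; 0, Real.exp (-(t / 2))], by
    simp [Matrix.det_fin_two_of, ← Real.exp_add]⟩

/-- The unipotent matrix `u(s)` generating the horocycle flow. -/
noncomputable def uMat (s : ℝ) : SL(2, ℝ) :=
  ⟨!![1, s; 0, 1], by simp [Matrix.det_fin_two_of]⟩

/-- The matrix topology on `SL(2,ℝ)`, induced from the space of matrices. -/
instance : TopologicalSpace SL(2, ℝ) :=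
  TopologicalSpace.induced (fun g => (g : Matrix (Fin 2) (Fin 2) ℝ)) inferInstance

/-- The element `-1` of `SL(2,ℝ)`. -/
def negOne : SL(2, ℝ) := ⟨!![-1, 0; 0, -1], by norm_num [Matrix.det_fin_two_of]⟩

/-- The translation length `ℓ(γ) = inf {dist(z, γ·z) : z ∈ ℍ}`. -/
noncomputable def transLen (γ : SL(2, ℝ)) : ℝ := ⨅ z : ℍ, dist z (γ • z)

/-- The set `{γ·g₀·u(s) : γ ∈ Γ, s ∈ ℝ}`, i.e. the lift to `SL(2,ℝ)` of the horocycle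
orbit of the point `Γg₀` of `Γ\SL(2,ℝ)`. -/
def horoSat (Γ : Subgroup SL(2, ℝ)) (g₀ : SL(2, ℝ)) : Set SL(2, ℝ) :=
  {x | ∃ γ ∈ Γ, ∃ s : ℝ, x = γ * g₀ * uMat s}

/-- The geodesic ray determined by `g`: `r_g(t) = (g·d(t))·i ∈ ℍ`. -/
noncomputable def ray (g : SL(2, ℝ)) (t : ℝ) : ℍ := (g * dMat t) • UpperHalfPlane.I

/-- `Γ` has bounded geometry below `a`: every nontrivial element of `Γ` moves every point
of `ℍ` at distance at least `a`. -/
def BoundedGeomBelow (Γ : Subgroup SL(2, ℝ)) (a : ℝ) : Prop :=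
  ∀ (z : ℍ) (γ : SL(2, ℝ)), γ ∈ Γ → γ ≠ 1 → γ ≠ negOne → a ≤ dist z (γ • z)

/-- The quotient surface `Γ\ℍ` is coarsely tame: it is noncompact and there is `b > 0`
such that every geodesic ray either stays in a compact region of the quotient or meets
closed geodesics of length at most `b` at arbitrarily large times. -/
def CoarselyTame (Γ : Subgroup SL(2, ℝ)) : Prop :=
  (¬ ∃ K : Set ℍ, IsCompact K ∧ ∀ z : ℍ, ∃ γ ∈ Γ, γ • z ∈ K) ∧
    ∃ b > 0, ∀ g : SL(2, ℝ),
      (∃ K : Set ℍ, IsCompact K ∧ ∀ t ≥ (0 : ℝ), ∃ γ ∈ Γ, γ • ray g t ∈ K) ∨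
      (∀ T : ℝ, ∃ t ≥ T, ∃ γ ∈ Γ, γ ≠ 1 ∧ γ ≠ negOne ∧
        dist (ray g t) (γ • ray g t) = transLen γ ∧ transLen γ ≤ b)

/-- The squared Frobenius norm of an element of `SL(2,ℝ)`. -/
def sqNorm (g : SL(2, ℝ)) : ℝ := g 0 0 ^ 2 + g 0 1 ^ 2 + g 1 0 ^ 2 + g 1 1 ^ 2

lemma det_entries (g : SL(2, ℝ)) : g 0 0 * g 1 1 - g 0 1 * g 1 0 = 1 := by
  have h := g.det_coe
  rwa [Matrix.det_fin_two] at h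

lemma coe_dMat (t : ℝ) : (dMat t : Matrix (Fin 2) (Fin 2) ℝ) =
    !![Real.exp (t / 2), 0; 0, Real.exp (-(t / 2))] := rfl

lemma coe_uMat (s : ℝ) : (uMat s : Matrix (Fin 2) (Fin 2) ℝ) = !![1, s; 0, 1] := rfl

lemma cosh_dist_I_smul_I (g : SL(2, ℝ)) :
    Real.cosh (dist UpperHalfPlane.I (g • UpperHalfPlane.I)) = sqNorm g / 2 := by
  have hdet := det_entries g
  have hpos : 0 < g 1 0 ^ 2 + g 1 1 ^ 2 := by
    by_contra hle
    have h0 : g 1 0 = 0 := by nlinarith [sq_nonneg (g 1 0), sq_nonneg (g 1 1)]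
    have h1 : g 1 1 = 0 := by nlinarith [sq_nonneg (g 1 0), sq_nonneg (g 1 1)]
    simp [h0, h1] at hdet
  have hcoe : ((g • UpperHalfPlane.I : ℍ) : ℂ) =
      (g 0 0 * Complex.I + g 0 1) / (g 1 0 * Complex.I + g 1 1) := by
    rw [UpperHalfPlane.coe_specialLinearGroup_apply]
    simp
  have hnormSq : Complex.normSq (g 1 0 * Complex.I + g 1 1) = g 1 0 ^ 2 + g 1 1 ^ 2 := by
    simp [Complex.normSq_apply]; ring
  have hre : (g • UpperHalfPlane.I : ℍ).re =
      (g 0 1 * g 1 1 + g 0 0 * g 1 0) / (g 1 0 ^ 2 + g 1 1 ^ 2) := by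
    rw [← UpperHalfPlane.coe_re, hcoe, Complex.div_re, hnormSq]
    simp; ring
  have him : (g • UpperHalfPlane.I : ℍ).im = 1 / (g 1 0 ^ 2 + g 1 1 ^ 2) := by
    rw [← UpperHalfPlane.coe_im, hcoe, Complex.div_im, hnormSq, ← sub_div]
    congr 1
    simpa [mul_comm] using hdet
  rw [UpperHalfPlane.cosh_dist', hre, him, UpperHalfPlane.I_re, UpperHalfPlane.I_im, sqNorm]
  field_simp
  linear_combination (-(g 0 0 * g 1 1 - g 0 1 * g 1 0) - 1) * hdet

lemma cosh_dist_smul_I (γ k : SL(2, ℝ)) :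
    Real.cosh (dist (k • UpperHalfPlane.I) (γ • k • UpperHalfPlane.I)) =
      sqNorm (k⁻¹ * γ * k) / 2 := by
  have heq : k * (k⁻¹ * γ * k) = γ * k := by group
  rw [← cosh_dist_I_smul_I, ← dist_smul k UpperHalfPlane.I, ← mul_smul, ← mul_smul, heq]

/-- The linear coefficient of a real polynomial of degree four with a minimum at `0` vanishes. -/
lemma linear_coeff_eq_zero {c₁ c₂ c₃ c₄ : ℝ}
    (h : ∀ x : ℝ, 0 ≤ c₁ * x + c₂ * x ^ 2 + c₃ * x ^ 3 + c₄ * x ^ 4) : c₁ = 0 := by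
  have hd : HasDerivAt (fun x : ℝ => c₁ * x + c₂ * x ^ 2 + c₃ * x ^ 3 + c₄ * x ^ 4) c₁ 0 := by
    have := ((((hasDerivAt_id (0 : ℝ)).const_mul c₁).add
      ((hasDerivAt_pow 2 (0 : ℝ)).const_mul c₂)).add
      ((hasDerivAt_pow 3 (0 : ℝ)).const_mul c₃)).add ((hasDerivAt_pow 4 (0 : ℝ)).const_mul c₄)
    exact this.congr_deriv (by simp)
  refine IsLocalMin.hasDerivAt_eq_zero (Filter.Eventually.of_forall fun x => ?_) hd
  simpa using h x

/-- A matrix whose Frobenius norm is minimal in its conjugacy class is symmetric, unless it is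
a rotation. -/
lemma symm_of_sqNorm_le_conj (h : SL(2, ℝ))
    (hmin : ∀ k : SL(2, ℝ), sqNorm h ≤ sqNorm (k⁻¹ * h * k))
    (hgt : 2 < sqNorm h) : h 0 1 = h 1 0 := by
  have hdet := det_entries h
  have hU : ∀ x : ℝ, sqNorm ((uMat x)⁻¹ * h * uMat x) =
      (h 0 0 - x * h 1 0) ^ 2 + (h 0 1 + x * h 0 0 - x * (h 1 1 + x * h 1 0)) ^ 2
        + h 1 0 ^ 2 + (h 1 1 + x * h 1 0) ^ 2 := by
    intro x
    simp [sqNorm, coe_uMat, Matrix.SpecialLinearGroup.coe_inv, Matrix.mul_apply, Fin.sum_univ_two,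
      Matrix.adjugate_fin_two, Matrix.vecMul, dotProduct]
    ring
  have hD : ∀ x : ℝ, sqNorm ((dMat x)⁻¹ * h * dMat x) =
      h 0 0 ^ 2 + (h 0 1 * Real.exp (-x)) ^ 2 + (h 1 0 * Real.exp x) ^ 2 + h 1 1 ^ 2 := by
    intro x
    have e1 : Real.exp (x / 2) * Real.exp (-(x / 2)) = 1 := by simp [← Real.exp_add]
    have e2 : Real.exp x = Real.exp (x / 2) * Real.exp (x / 2) := by
      rw [← Real.exp_add]; congr 1; ring
    have e3 : Real.exp (-x) = Real.exp (-(x / 2)) * Real.exp (-(x / 2)) := by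
      rw [← Real.exp_add]; congr 1; ring
    rw [e2, e3]
    simp [sqNorm, coe_dMat, Matrix.SpecialLinearGroup.coe_inv, Matrix.mul_apply, Fin.sum_univ_two,
      Matrix.adjugate_fin_two, Matrix.vecMul, dotProduct]
    generalize Real.exp (x / 2) = u at *
    generalize Real.exp (-(x / 2)) = v at *
    linear_combination (h 0 0 ^ 2 + h 1 1 ^ 2) * (u * v + 1) * e1
  have hlin : 2 * ((h 0 0 - h 1 1) * (h 0 1 - h 1 0)) = 0 := by
    refine linear_coeff_eq_zero (c₂ := h 1 0 ^ 2 + (h 0 0 - h 1 1) ^ 2 - 2 * h 0 1 * h 1 0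
      + h 1 0 ^ 2) (c₃ := -2 * (h 0 0 - h 1 1) * h 1 0) (c₄ := h 1 0 ^ 2) fun x => ?_
    have := hmin (uMat x)
    rw [hU, sqNorm] at this
    linarith
  have hsq : h 0 1 ^ 2 = h 1 0 ^ 2 := by
    have hd : HasDerivAt (fun x : ℝ => (h 0 1 * Real.exp (-x)) ^ 2 + (h 1 0 * Real.exp x) ^ 2)
        (-2 * h 0 1 ^ 2 + 2 * h 1 0 ^ 2) 0 := by
      have := ((((hasDerivAt_neg (0 : ℝ)).exp).const_mul (h 0 1)).pow 2).add
        (((Real.hasDerivAt_exp 0).const_mul (h 1 0)).pow 2)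
      exact this.congr_deriv (by simp; ring)
    have := IsLocalMin.hasDerivAt_eq_zero (Filter.Eventually.of_forall fun x => by
      have := hmin (dMat x)
      rw [hD, sqNorm] at this
      simp only [neg_zero, Real.exp_zero, mul_one]
      linarith) hd
    linarith
  rcases mul_eq_zero.1 ((mul_eq_zero.1 hlin).resolve_left two_ne_zero) with hps | hqr
  · rcases sq_eq_sq_iff_eq_or_eq_neg.1 hsq with hq | hq
    · exact hq
    · rw [sqNorm, hq] at hgt
      rw [hq] at hdet
      have hp : h 0 0 = h 1 1 := by linarith
      rw [hp] at hgt hdet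
      nlinarith
  · linarith

/-- If `γ` translates along an axis through `g·i`, then `g⁻¹ γ g` is symmetric. -/
lemma symm_conj_of_dist_eq_transLen (g γ : SL(2, ℝ)) (hpos : 0 < transLen γ)
    (haxis : dist (g • UpperHalfPlane.I) (γ • g • UpperHalfPlane.I) = transLen γ) :
    (g⁻¹ * γ * g) 0 1 = (g⁻¹ * γ * g) 1 0 := by
  have hg := cosh_dist_smul_I γ g
  apply symm_of_sqNorm_le_conj
  · intro k
    have hk := cosh_dist_smul_I γ (g * k)
    have hle : transLen γ ≤ dist ((g * k) • UpperHalfPlane.I) (γ • (g * k) • UpperHalfPlane.I) :=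
      ciInf_le ⟨0, by rintro _ ⟨z, rfl⟩; exact dist_nonneg⟩ ((g * k) • UpperHalfPlane.I)
    have hcosh := Real.cosh_le_cosh.2 (abs_le_abs_of_nonneg hpos.le hle)
    rw [← haxis, hg, hk] at hcosh
    have heq : (g * k)⁻¹ * γ * (g * k) = k⁻¹ * (g⁻¹ * γ * g) * k := by group
    rw [heq] at hcosh
    linarith
  · have := Real.one_lt_cosh.2 (haxis ▸ hpos).ne'
    linarith

/-- Conjugating a symmetric matrix by `d(t)` and clearing the upper right entry with `u(x)`. -/
lemma exists_conj_mul_uMat (H : SL(2, ℝ)) (t : ℝ) (hsymm : H 0 1 = H 1 0) (hne : H 0 0 ≠ 0) :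
    ∃ x : ℝ, ((dMat t * H * (dMat t)⁻¹ * uMat x : SL(2, ℝ)) : Matrix (Fin 2) (Fin 2) ℝ) =
      !![H 0 0, 0; Real.exp (-t) * H 1 0, (H 0 0)⁻¹] := by
  refine ⟨-(Real.exp t * H 1 0 / H 0 0), ?_⟩
  have hdet := det_entries H
  have e1 : Real.exp (t / 2) * Real.exp (-(t / 2)) = 1 := by simp [← Real.exp_add]
  have e2 : Real.exp t = Real.exp (t / 2) * Real.exp (t / 2) := by
    rw [← Real.exp_add]; congr 1; ring
  have e3 : Real.exp (-t) = Real.exp (-(t / 2)) * Real.exp (-(t / 2)) := by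
    rw [← Real.exp_add]; congr 1; ring
  rw [e2, e3]
  have hinv : (H 0 0)⁻¹ = H 1 1 - H 1 0 ^ 2 / H 0 0 := by
    field_simp
    rw [hsymm] at hdet
    linarith
  rw [hinv]
  ext i j
  fin_cases i <;> fin_cases j <;>
    simp [coe_dMat, coe_uMat, Matrix.SpecialLinearGroup.coe_inv, Matrix.mul_apply, Fin.sum_univ_two,
      Matrix.adjugate_fin_two, Matrix.vecMul, dotProduct, hsymm] <;>
    generalize Real.exp (t / 2) = u at * <;>
    generalize Real.exp (-(t / 2)) = v at *
  · linear_combination H 0 0 * e1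
  · field_simp
    linear_combination (-H 1 0 * u ^ 2) * e1
  · ring
  · field_simp
    linear_combination (H 1 1 * H 0 0 - H 1 0 ^ 2 * (u * v + 1)) * e1

/-- A symmetric matrix or its inverse, once squared, has a large and controlled upper left
entry. -/
lemma exists_symm_power (h : SL(2, ℝ)) (hsymm : h 0 1 = h 1 0) {A B : ℝ}
    (hA : 2 * A ≤ sqNorm h) (hB : sqNorm h ≤ B) :
    ∃ m : ℤ, (h ^ m) 0 1 = (h ^ m) 1 0 ∧ (h ^ m) 0 0 ∈ Set.Icc A B ∧ |(h ^ m) 1 0| ≤ B := by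
  have hdet := det_entries h
  rw [sqNorm, hsymm] at hA hB
  rw [hsymm] at hdet
  have hpq := sq_nonneg (h 0 0 - h 1 1)
  have hbound : |h 1 0 * (h 0 0 + h 1 1)| ≤ B := by
    rw [abs_le]
    constructor <;>
    nlinarith [sq_nonneg (h 1 0 * 2 + (h 0 0 + h 1 1)), sq_nonneg (h 1 0 * 2 - (h 0 0 + h 1 1)),
      sq_nonneg (h 1 0 + h 0 0), sq_nonneg (h 1 0 + h 1 1), sq_nonneg (h 1 0 - h 0 0),
      sq_nonneg (h 1 0 - h 1 1)]
  have h2 : ((h ^ (2 : ℤ) : SL(2, ℝ)) : Matrix (Fin 2) (Fin 2) ℝ) =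
      !![h 0 0 ^ 2 + h 1 0 ^ 2, h 1 0 * (h 0 0 + h 1 1);
        h 1 0 * (h 0 0 + h 1 1), h 1 0 ^ 2 + h 1 1 ^ 2] := by
    rw [zpow_two]
    ext i j
    fin_cases i <;> fin_cases j <;> simp [Matrix.mul_apply, Fin.sum_univ_two, hsymm] <;> ring
  rcases le_total (h 1 1 ^ 2) (h 0 0 ^ 2) with hle | hle
  · refine ⟨2, ?_⟩
    rw [h2]
    refine ⟨by simp, ?_, by simpa using hbound⟩
    simp only [Matrix.of_apply, Matrix.cons_val', Matrix.cons_val_zero, Matrix.cons_val_fin_one]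
    constructor <;> nlinarith
  · refine ⟨-2, ?_⟩
    rw [_root_.zpow_neg, Matrix.SpecialLinearGroup.coe_inv, h2, Matrix.adjugate_fin_two]
    refine ⟨by simp, ?_, by simpa using hbound⟩
    simp only [Matrix.of_apply, Matrix.cons_val', Matrix.cons_val_zero, Matrix.cons_val_fin_one,
      Matrix.cons_val_one]
    constructor <;> nlinarith

/-- Near the axis of an element of `Γ`, the horocycle orbit of `Γg₀` comes close to `g₀ d(t₀)`
with `exp (t₀ / 2) = P`. -/
lemma exists_mem_horoSat (Γ : Subgroup SL(2, ℝ)) (g₀ γ : SL(2, ℝ)) (hγ : γ ∈ Γ) {a b t : ℝ}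
    (ha : 0 < a)
    (haxis : dist ((g₀ * dMat t) • UpperHalfPlane.I)
      (γ • ((g₀ * dMat t) • UpperHalfPlane.I)) = transLen γ)
    (hlen : a ≤ transLen γ ∧ transLen γ ≤ b) :
    ∃ y ∈ horoSat Γ g₀, ∃ P ∈ Set.Icc (Real.cosh a) (2 * Real.cosh b),
      ∃ c : ℝ, |c| ≤ 2 * Real.cosh b ∧ (y : Matrix (Fin 2) (Fin 2) ℝ) =
        (g₀ : Matrix (Fin 2) (Fin 2) ℝ) * !![P, 0; Real.exp (-t) * c, P⁻¹] := by
  have hpos := ha.trans_le hlen.1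
  have hnorm := cosh_dist_smul_I γ (g₀ * dMat t)
  have hsymm := symm_conj_of_dist_eq_transLen (g₀ * dMat t) γ hpos haxis
  rw [haxis] at hnorm
  have hca := Real.cosh_le_cosh.2 (abs_le_abs_of_nonneg ha.le hlen.1)
  have hcb := Real.cosh_le_cosh.2 (abs_le_abs_of_nonneg hpos.le hlen.2)
  obtain ⟨m, hm, hP, hc⟩ := exists_symm_power _ hsymm (A := Real.cosh a) (B := 2 * Real.cosh b)
    (by linarith) (by linarith)
  obtain ⟨x, hx⟩ := exists_conj_mul_uMat _ t hm ((Real.cosh_pos a).trans_le hP.1).ne'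
  refine ⟨γ ^ m * g₀ * uMat x, ⟨γ ^ m, Γ.zpow_mem hγ m, x, rfl⟩, _, hP, _, hc, ?_⟩
  rw [← hx, ← Matrix.SpecialLinearGroup.coe_mul]
  congr 1
  have hconj : ((g₀ * dMat t)⁻¹ * γ * (g₀ * dMat t)) ^ m =
      (g₀ * dMat t)⁻¹ * γ ^ m * (g₀ * dMat t) := by
    simpa using conj_zpow (i := m) (a := (g₀ * dMat t)⁻¹) (b := γ)
  rw [hconj]
  simp only [mul_assoc, _root_.mul_inv_rev, mul_inv_cancel_left]
  rfl

/-- **Key Lemma.** Let `Γ` be a discrete subgroup of `SL(2,ℝ)`, `g₀ ∈ SL(2,ℝ)`,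
`0 < a ≤ b`. If the geodesic ray `t ↦ (g₀·d(t))·i` meets, at a sequence of times `t_n → +∞`,
axes of elements `γ_n ∈ Γ` of translation length in `[a, b]`, then there is `t₀ > 0` such that
`g₀·d(t₀)` lies in the closure of `{γ·g₀·u(s) : γ ∈ Γ, s ∈ ℝ}`. -/
theorem key_lemma (Γ : Subgroup SL(2, ℝ)) (hdisc : DiscreteTopology Γ)
    (g₀ : SL(2, ℝ)) (a b : ℝ) (ha : 0 < a) (hab : a ≤ b)
    (γ : ℕ → SL(2, ℝ)) (hγ : ∀ n, γ n ∈ Γ)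
    (t : ℕ → ℝ) (ht : Filter.Tendsto t Filter.atTop Filter.atTop)
    (haxis : ∀ n, dist ((g₀ * dMat (t n)) • UpperHalfPlane.I)
        (γ n • ((g₀ * dMat (t n)) • UpperHalfPlane.I)) = transLen (γ n))
    (hlen : ∀ n, a ≤ transLen (γ n) ∧ transLen (γ n) ≤ b) :
    ∃ t₀ > (0 : ℝ), g₀ * dMat t₀ ∈ closure (horoSat Γ g₀) := by
  choose y hy P hP c hc hyP using fun n =>
    exists_mem_horoSat Γ g₀ (γ n) (hγ n) ha (haxis n) (hlen n)
  obtain ⟨p, hp, φ, hφ, hlim⟩ := isCompact_Icc.tendsto_subseq hP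
  have hp1 : 1 < p := (Real.one_lt_cosh.2 ha.ne').trans_le hp.1
  have hp0 : 0 < p := one_pos.trans hp1
  refine ⟨2 * Real.log p, by have := Real.log_pos hp1; linarith, ?_⟩
  refine mem_closure_of_tendsto (b := Filter.atTop) (f := y ∘ φ) ?_
    (Filter.Eventually.of_forall fun n => hy (φ n))
  rw [(Topology.IsInducing.induced
    (fun g : SL(2, ℝ) => (g : Matrix (Fin 2) (Fin 2) ℝ))).tendsto_nhds_iff]
  have hd : ((g₀ * dMat (2 * Real.log p) : SL(2, ℝ)) : Matrix (Fin 2) (Fin 2) ℝ) =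
      (g₀ : Matrix (Fin 2) (Fin 2) ℝ) * !![p, 0; 0, p⁻¹] := by
    rw [Matrix.SpecialLinearGroup.coe_mul]
    simp [coe_dMat, Real.exp_neg, Real.exp_log hp0]
  have hcomp : (fun g : SL(2, ℝ) => (g : Matrix (Fin 2) (Fin 2) ℝ)) ∘ y ∘ φ = fun n =>
      (g₀ : Matrix (Fin 2) (Fin 2) ℝ) *
        !![P (φ n), 0; Real.exp (-t (φ n)) * c (φ n), (P (φ n))⁻¹] :=
    funext fun n => hyP (φ n)
  rw [hcomp, hd]
  have hzero : Filter.Tendsto (fun n => Real.exp (-t (φ n)) * c (φ n)) Filter.atTop (nhds 0) := by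
    refine Filter.Tendsto.zero_mul_isBoundedUnder_le ?_
      (Filter.isBoundedUnder_of ⟨2 * Real.cosh b, fun n => hc (φ n)⟩)
    exact Real.tendsto_exp_neg_atTop_nhds_zero.comp (ht.comp hφ.tendsto_atTop)
  refine Filter.Tendsto.const_mul _ ?_
  refine tendsto_pi_nhds.2 fun i => tendsto_pi_nhds.2 fun j => ?_
  fin_cases i <;> fin_cases j
  · simpa [Function.comp_def] using hlim
  · simp
  · simpa using hzero
  · simpa using hlim.inv₀ hp0.ne'
end

section
/- Let Γ be a subgroup of SL(2,ℝ) that has bounded geometry below some a > 0, and suppose the quotient surface Γ\ℍ is coarsely tame. Then the horocycle flow on the unit tangent bundle Γ\SL(2,ℝ) admits no minimal set. Concretely: for every nonempty closed subset C ⊆ SL(2,ℝ) satisfying γ·C = C for all γ ∈ Γ and C·u(s) = C for all s ∈ ℝ, there exists a nonempty closed proper subset C' ⊊ C satisfying the same two invariance properties. (This recovers a result of Matsumoto.) -/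
open Matrix Real
open scoped MatrixGroups UpperHalfPlane

namespace HorocycleFlow

open Filter Topology

/-- The squared Frobenius norm of an element of `SL(2,ℝ)`. -/
def frob (g : SL(2, ℝ)) : ℝ := g 0 0 ^ 2 + g 0 1 ^ 2 + g 1 0 ^ 2 + g 1 1 ^ 2

theorem det_eq (g : SL(2, ℝ)) : g 0 0 * g 1 1 - g 0 1 * g 1 0 = 1 := by
  rw [← Matrix.det_fin_two]; exact g.2

theorem mul_entry (g h : SL(2, ℝ)) (i j : Fin 2) :
    (g * h) i j = g i 0 * h 0 j + g i 1 * h 1 j := by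
  simp [Matrix.mul_apply, Fin.sum_univ_two]

@[simp] theorem inv_entry₀₀ (g : SL(2, ℝ)) : g⁻¹ 0 0 = g 1 1 := by
  rw [Matrix.SpecialLinearGroup.SL2_inv_expl]; simp

@[simp] theorem inv_entry₀₁ (g : SL(2, ℝ)) : g⁻¹ 0 1 = -g 0 1 := by
  rw [Matrix.SpecialLinearGroup.SL2_inv_expl]; simp

@[simp] theorem inv_entry₁₀ (g : SL(2, ℝ)) : g⁻¹ 1 0 = -g 1 0 := by
  rw [Matrix.SpecialLinearGroup.SL2_inv_expl]; simp

@[simp] theorem inv_entry₁₁ (g : SL(2, ℝ)) : g⁻¹ 1 1 = g 0 0 := by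
  rw [Matrix.SpecialLinearGroup.SL2_inv_expl]; simp

@[simp] theorem uMat_entry₀₀ (s : ℝ) : uMat s 0 0 = 1 := by simp [uMat]
@[simp] theorem uMat_entry₀₁ (s : ℝ) : uMat s 0 1 = s := by simp [uMat]
@[simp] theorem uMat_entry₁₀ (s : ℝ) : uMat s 1 0 = 0 := by simp [uMat]
@[simp] theorem uMat_entry₁₁ (s : ℝ) : uMat s 1 1 = 1 := by simp [uMat]

@[simp] theorem dMat_entry₀₀ (t : ℝ) : dMat t 0 0 = exp (t / 2) := by simp [dMat]
@[simp] theorem dMat_entry₀₁ (t : ℝ) : dMat t 0 1 = 0 := by simp [dMat]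
@[simp] theorem dMat_entry₁₀ (t : ℝ) : dMat t 1 0 = 0 := by simp [dMat]
@[simp] theorem dMat_entry₁₁ (t : ℝ) : dMat t 1 1 = exp (-(t / 2)) := by simp [dMat]

theorem ext_entry {g h : SL(2, ℝ)} (h₀₀ : g 0 0 = h 0 0) (h₀₁ : g 0 1 = h 0 1)
    (h₁₀ : g 1 0 = h 1 0) (h₁₁ : g 1 1 = h 1 1) : g = h := by
  ext i j; fin_cases i <;> fin_cases j <;> assumption

/-- The diagonal matrix `diag(p, p⁻¹)`. -/
noncomputable def diagMat (p : ℝˣ) : SL(2, ℝ) :=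
  ⟨!![(p : ℝ), 0; 0, (p : ℝ)⁻¹], by simp [Matrix.det_fin_two_of]⟩

@[simp] theorem diagMat_entry₀₀ (p : ℝˣ) : diagMat p 0 0 = p := by simp [diagMat]
@[simp] theorem diagMat_entry₀₁ (p : ℝˣ) : diagMat p 0 1 = 0 := by simp [diagMat]
@[simp] theorem diagMat_entry₁₀ (p : ℝˣ) : diagMat p 1 0 = 0 := by simp [diagMat]
@[simp] theorem diagMat_entry₁₁ (p : ℝˣ) : diagMat p 1 1 = (p : ℝ)⁻¹ := by simp [diagMat]

theorem diagMat_mul (p q : ℝˣ) : diagMat (p * q) = diagMat p * diagMat q := by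
  apply ext_entry <;> simp only [mul_entry] <;> simp [mul_comm]

theorem diagMat_zpow (p : ℝˣ) (n : ℤ) : diagMat (p ^ n) = diagMat p ^ n :=
  map_zpow (MonoidHom.mk' diagMat diagMat_mul) p n

/-- The rotation `[[0, -1], [1, 0]]`, which fixes `i` and reverses the geodesic flow. -/
def flip : SL(2, ℝ) := ⟨!![0, -1; 1, 0], by simp [Matrix.det_fin_two_of]⟩

@[simp] theorem flip_entry₀₀ : flip 0 0 = 0 := by simp [flip]
@[simp] theorem flip_entry₀₁ : flip 0 1 = -1 := by simp [flip]
@[simp] theorem flip_entry₁₀ : flip 1 0 = 1 := by simp [flip]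
@[simp] theorem flip_entry₁₁ : flip 1 1 = 0 := by simp [flip]

theorem frob_nonneg (g : SL(2, ℝ)) : 0 ≤ frob g := by unfold frob; positivity

theorem frob_inv (g : SL(2, ℝ)) : frob g⁻¹ = frob g := by simp [frob]; ring

theorem frob_one : frob 1 = 2 := by simp [frob]; norm_num

theorem frob_mul_le (g h : SL(2, ℝ)) : frob (g * h) ≤ frob g * frob h := by
  simp only [frob, mul_entry]
  nlinarith [sq_nonneg (g 0 0 * h 1 0 - g 0 1 * h 0 0), sq_nonneg (g 0 0 * h 1 1 - g 0 1 * h 0 1),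
    sq_nonneg (g 1 0 * h 1 0 - g 1 1 * h 0 0), sq_nonneg (g 1 0 * h 1 1 - g 1 1 * h 0 1)]

theorem frob_mul_flip (g : SL(2, ℝ)) : frob (g * flip) = frob g := by
  simp [frob, mul_entry]; ring

theorem two_cosh_dist (g : SL(2, ℝ)) :
    2 * cosh (dist UpperHalfPlane.I (g • UpperHalfPlane.I)) = frob g := by
  have hd := det_eq g
  have hpos : 0 < g 1 0 ^ 2 + g 1 1 ^ 2 := by
    by_contra hcon
    have h0 : g 1 0 = 0 := by nlinarith [sq_nonneg (g 1 0), sq_nonneg (g 1 1)]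
    have h1 : g 1 1 = 0 := by nlinarith [sq_nonneg (g 1 0), sq_nonneg (g 1 1)]
    rw [h0, h1] at hd; simp at hd
  have hval : ((g • UpperHalfPlane.I : ℍ) : ℂ) =
      ⟨(g 0 0 * g 1 0 + g 0 1 * g 1 1) / (g 1 0 ^ 2 + g 1 1 ^ 2),
        1 / (g 1 0 ^ 2 + g 1 1 ^ 2)⟩ := by
    rw [UpperHalfPlane.coe_specialLinearGroup_apply]
    have hden : ((algebraMap ℝ ℝ) (g 1 0) : ℂ) * (UpperHalfPlane.I : ℍ) +
        ((algebraMap ℝ ℝ) (g 1 1) : ℂ) ≠ 0 := by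
      intro h
      have h1 := congrArg Complex.re h
      have h2 := congrArg Complex.im h
      simp at h1 h2
      rw [h1, h2] at hpos; simp at hpos
    rw [div_eq_iff hden]
    apply Complex.ext
    · simp
      field_simp
      linear_combination (-g 1 0) * hd
    · simp
      field_simp
      linear_combination (g 1 1) * hd
  have him : (g • UpperHalfPlane.I : ℍ).im = 1 / (g 1 0 ^ 2 + g 1 1 ^ 2) := by
    rw [← UpperHalfPlane.coe_im, hval]
  rw [UpperHalfPlane.cosh_dist, him, Complex.dist_eq, hval, ← Complex.normSq_eq_norm_sq,
    Complex.normSq_apply]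
  simp [frob]
  field_simp
  have : g 0 0 ^ 2 + g 0 1 ^ 2 = ((g 0 0 * g 1 0 + g 0 1 * g 1 1) ^ 2 + 1) /
      (g 1 0 ^ 2 + g 1 1 ^ 2) := by
    rw [eq_div_iff hpos.ne']
    linear_combination (g 0 0 * g 1 1 - g 0 1 * g 1 0 + 1) * hd
  rw [this]
  field_simp
  ring

theorem two_cosh_dist_smul (m γ : SL(2, ℝ)) :
    2 * cosh (dist (m • UpperHalfPlane.I) (γ • m • UpperHalfPlane.I)) = frob (m⁻¹ * γ * m) := by
  rw [← two_cosh_dist, ← dist_smul m UpperHalfPlane.I]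
  simp [smul_smul, mul_assoc]

theorem continuous_entry (i j : Fin 2) : Continuous fun g : SL(2, ℝ) => g i j :=
  (continuous_id.matrix_elem i j).comp continuous_induced_dom

theorem continuous_of_entry {X : Type*} [TopologicalSpace X] {f : X → SL(2, ℝ)}
    (h : ∀ i j, Continuous fun x => f x i j) : Continuous f :=
  continuous_induced_rng.2 (continuous_pi fun i => continuous_pi fun j => h i j)

theorem continuous_const_mul (g : SL(2, ℝ)) : Continuous fun x : SL(2, ℝ) => g * x :=
  continuous_of_entry fun i j => by
    simp only [mul_entry]
    exact ((continuous_entry _ _).const_mul _).add ((continuous_entry _ _).const_mul _)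

theorem continuous_mul_const (g : SL(2, ℝ)) : Continuous fun x : SL(2, ℝ) => x * g :=
  continuous_of_entry fun i j => by
    simp only [mul_entry]
    exact ((continuous_entry _ _).mul_const _).add ((continuous_entry _ _).mul_const _)

theorem continuous_inv : Continuous fun x : SL(2, ℝ) => x⁻¹ :=
  continuous_of_entry fun i j => by
    fin_cases i <;> fin_cases j <;> simp only [Fin.zero_eta, Fin.mk_one, inv_entry₀₀, inv_entry₀₁,
      inv_entry₁₀, inv_entry₁₁]
    exacts [continuous_entry _ _, (continuous_entry _ _).neg, (continuous_entry _ _).neg,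
      continuous_entry _ _]

theorem continuous_frob : Continuous frob :=
  ((((continuous_entry 0 0).pow 2).add ((continuous_entry 0 1).pow 2)).add
    ((continuous_entry 1 0).pow 2)).add ((continuous_entry 1 1).pow 2)

theorem isCompact_frob_le (M : ℝ) : IsCompact {g : SL(2, ℝ) | frob g ≤ M} := by
  have hemb : IsClosedEmbedding (fun g : SL(2, ℝ) => (g : Matrix (Fin 2) (Fin 2) ℝ)) := by
    refine ⟨⟨⟨rfl⟩, Subtype.val_injective⟩, ?_⟩
    have : Set.range (fun g : SL(2, ℝ) => (g : Matrix (Fin 2) (Fin 2) ℝ)) =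
        {A | A.det = 1} := Subtype.range_val
    rw [this]
    exact isClosed_eq continuous_id.matrix_det continuous_const
  have hK : IsCompact (Set.univ.pi fun _ : Fin 2 => Set.univ.pi fun _ : Fin 2 =>
      Set.Icc (-(1 + M)) (1 + M)) :=
    isCompact_univ_pi fun _ => isCompact_univ_pi fun _ => isCompact_Icc
  refine (hemb.isCompact_preimage hK).of_isClosed_subset
    (isClosed_le continuous_frob continuous_const) ?_
  intro g hg
  have hg' : frob g ≤ M := hg
  simp only [frob] at hg'
  intro i _ j _
  have h2 : (g i j) ^ 2 ≤ M := by
    fin_cases i <;> fin_cases j <;> simp <;>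
      nlinarith [sq_nonneg (g 0 0), sq_nonneg (g 0 1), sq_nonneg (g 1 0), sq_nonneg (g 1 1)]
  constructor
  · show -(1 + M) ≤ g i j
    nlinarith [sq_nonneg (g i j + 1)]
  · show g i j ≤ 1 + M
    nlinarith [sq_nonneg (g i j - 1)]

theorem uMat_mul (s t : ℝ) : uMat s * uMat t = uMat (s + t) := by
  apply ext_entry <;> simp only [mul_entry] <;> simp [add_comm]

theorem uMat_zero : uMat 0 = 1 := by apply ext_entry <;> simp

theorem dMat_mul_uMat_mul_dMat (t s : ℝ) : dMat t * uMat s * dMat (-t) = uMat (exp t * s) := by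
  have h : exp (t / 2) * exp (t / 2) = exp t := by rw [← exp_add]; congr 1; ring
  have h' : exp (t / 2) * exp (-(t / 2)) = 1 := by rw [← exp_add]; simp
  apply ext_entry <;> simp only [mul_entry] <;> simp [neg_div]
  · exact h'
  · rw [mul_right_comm, h]
  · rw [mul_comm]; exact h'

theorem flip_mul_dMat (t : ℝ) : flip * dMat t = dMat (-t) * flip := by
  apply ext_entry <;> simp only [mul_entry] <;> simp [neg_div]

theorem dMat_neg_mul (t : ℝ) : dMat (-t) * dMat t = 1 := by
  apply ext_entry <;> simp only [mul_entry] <;> simp [neg_div, ← exp_add]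

theorem inv_uMat (s : ℝ) : (uMat s)⁻¹ = uMat (-s) :=
  (eq_inv_of_mul_eq_one_left (by rw [uMat_mul]; simp [uMat_zero])).symm

theorem uMat_mul_diagMat (p : ℝˣ) (s : ℝ) :
    uMat s * diagMat p = diagMat p * uMat (s / (p : ℝ) ^ 2) := by
  have := p.ne_zero
  apply ext_entry <;> simp only [mul_entry] <;> simp
  field_simp

theorem exists_frob_conj_eq (γ : SL(2, ℝ)) (x : ℝ) {w : ℝ} (hw : 0 < w) :
    ∃ m : SL(2, ℝ), frob (m⁻¹ * γ * m) = (γ 0 0 - x * γ 1 0) ^ 2 + (γ 1 1 + x * γ 1 0) ^ 2 +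
      (γ 0 1 + x * (γ 0 0 - γ 1 1) - x ^ 2 * γ 1 0) ^ 2 / w + γ 1 0 ^ 2 * w := by
  obtain ⟨v, hv, hvw⟩ : ∃ v : ℝ, 0 < v ∧ v ^ 4 = w :=
    ⟨√√w, by positivity, by
      rw [show (√√w) ^ 4 = ((√√w) ^ 2) ^ 2 by ring, sq_sqrt (sqrt_nonneg _), sq_sqrt hw.le]⟩
  refine ⟨uMat x * diagMat (Units.mk0 v hv.ne'), ?_⟩
  rw [← hvw]
  simp only [frob, _root_.mul_inv_rev, mul_entry, inv_entry₀₀, inv_entry₀₁, inv_entry₁₀,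
    inv_entry₁₁,
    uMat_entry₀₀, uMat_entry₀₁, uMat_entry₁₀, uMat_entry₁₁, diagMat_entry₀₀, diagMat_entry₀₁,
    diagMat_entry₁₀, diagMat_entry₁₁, Units.val_mk0]
  field_simp
  ring

/-- A lower bound `A > 2` for the displacement function (in the form `2 cosh dist`) of `γ` bounds
the trace of `γ`. -/
theorem le_trace_sq_sub_two {γ : SL(2, ℝ)} {A : ℝ} (hA : 2 < A)
    (h : ∀ m : SL(2, ℝ), A ≤ frob (m⁻¹ * γ * m)) : A ≤ (γ 0 0 + γ 1 1) ^ 2 - 2 := by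
  have hd := det_eq γ
  have key : ∀ x w : ℝ, 0 < w → A ≤ (γ 0 0 - x * γ 1 0) ^ 2 + (γ 1 1 + x * γ 1 0) ^ 2 +
      (γ 0 1 + x * (γ 0 0 - γ 1 1) - x ^ 2 * γ 1 0) ^ 2 / w + γ 1 0 ^ 2 * w := by
    intro x w hw
    obtain ⟨m, hm⟩ := exists_frob_conj_eq γ x hw
    exact hm ▸ h m
  generalize γ 0 0 = a at *
  generalize γ 0 1 = b at *
  generalize γ 1 0 = c at *
  generalize γ 1 1 = d at *
  rcases eq_or_ne c 0 with rfl | hc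
  · rcases eq_or_ne a d with rfl | had
    · exfalso
      have hw : 0 < (2 * b ^ 2 + 1) / (A - 2) := div_pos (by positivity) (by linarith)
      have h1 := key 0 _ hw
      have h2 : b ^ 2 / ((2 * b ^ 2 + 1) / (A - 2)) < A - 2 := by
        rw [div_div_eq_mul_div, div_lt_iff₀ (by positivity)]
        nlinarith [sq_nonneg b]
      simp at h1
      nlinarith
    · have h1 := key (b / (d - a)) 1 one_pos
      have h2 : b + b / (d - a) * (a - d) = 0 := by
        have : d - a ≠ 0 := sub_ne_zero.2 had.symm
        field_simp; ring
      simp only [mul_zero, sub_zero, add_zero, h2] at h1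
      simp at h1
      nlinarith
  · obtain ⟨B, hB⟩ : ∃ B, B = b + (a - d) / (2 * c) * (a - d) - ((a - d) / (2 * c)) ^ 2 * c :=
      ⟨_, rfl⟩
    have hBc : B * c = ((a + d) ^ 2 - 4) / 4 := by
      rw [hB]; field_simp; linear_combination (-16 : ℝ) * hd
    have key' : ∀ w, 0 < w → A ≤ (a + d) ^ 2 / 2 + B ^ 2 / w + c ^ 2 * w := by
      intro w hw
      have h1 := key ((a - d) / (2 * c)) w hw
      rw [← hB] at h1
      have h2 : a - (a - d) / (2 * c) * c = (a + d) / 2 := by field_simp; ring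
      have h3 : d + (a - d) / (2 * c) * c = (a + d) / 2 := by field_simp; ring
      rw [h2, h3] at h1
      linarith [h1]
    rcases eq_or_ne B 0 with hB0 | hB0
    · exfalso
      have h1 := key' ((A - 2) / (2 * c ^ 2)) (div_pos (by linarith) (by positivity))
      have h2 : c ^ 2 * ((A - 2) / (2 * c ^ 2)) = (A - 2) / 2 := by field_simp
      rw [h2] at h1
      simp [hB0] at h1 hBc
      linarith
    · have h1 := key' (|B| / |c|) (by positivity)
      have h2 : B ^ 2 / (|B| / |c|) = |B * c| := by
        rw [abs_mul, ← sq_abs B]; field_simp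
      have h3 : c ^ 2 * (|B| / |c|) = |B * c| := by
        rw [abs_mul, ← sq_abs c]; field_simp
      rw [h2, h3, hBc] at h1
      rcases abs_cases (((a + d) ^ 2 - 4) / 4) with ⟨h4, h5⟩ | ⟨h4, h5⟩ <;> rw [h4] at h1 <;>
        nlinarith

theorem two_cosh_le_frob_conj {Γ : Subgroup SL(2, ℝ)} {a : ℝ} (ha : 0 < a)
    (hbg : BoundedGeomBelow Γ a) {γ : SL(2, ℝ)} (hγ : γ ∈ Γ) (h1 : γ ≠ 1) (h2 : γ ≠ negOne)
    (m : SL(2, ℝ)) : 2 * cosh a ≤ frob (m⁻¹ * γ * m) := by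
  rw [← two_cosh_dist_smul]
  have := hbg (m • UpperHalfPlane.I) γ hγ h1 h2
  have : cosh a ≤ cosh (dist (m • UpperHalfPlane.I) (γ • m • UpperHalfPlane.I)) := by
    rw [cosh_le_cosh, abs_of_pos ha, abs_of_nonneg dist_nonneg]; exact this
  linarith

theorem two_lt_two_mul_cosh {a : ℝ} (ha : 0 < a) : 2 < 2 * cosh a := by
  linarith [one_lt_cosh.2 ha.ne']

theorem two_cosh_le_trace_sq {Γ : Subgroup SL(2, ℝ)} {a : ℝ} (ha : 0 < a)
    (hbg : BoundedGeomBelow Γ a) {γ : SL(2, ℝ)} (hγ : γ ∈ Γ) (h1 : γ ≠ 1) (h2 : γ ≠ negOne) :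
    2 * cosh a ≤ (γ 0 0 + γ 1 1) ^ 2 - 2 :=
  le_trace_sq_sub_two (two_lt_two_mul_cosh ha) (two_cosh_le_frob_conj ha hbg hγ h1 h2)

theorem trace_conj (m γ : SL(2, ℝ)) :
    (m⁻¹ * γ * m) 0 0 + (m⁻¹ * γ * m) 1 1 = γ 0 0 + γ 1 1 := by
  simp only [mul_entry, inv_entry₀₀, inv_entry₀₁, inv_entry₁₀, inv_entry₁₁]
  linear_combination (γ 0 0 + γ 1 1) * det_eq m

/-- An element of bounded geometry translating `m • i` along its axis is symmetric when conjugated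
by `m`. -/
theorem conj_symm_of_dist_eq_transLen {Γ : Subgroup SL(2, ℝ)} {a : ℝ} (ha : 0 < a)
    (hbg : BoundedGeomBelow Γ a) {γ : SL(2, ℝ)} (hγ : γ ∈ Γ) (h1 : γ ≠ 1) (h2 : γ ≠ negOne)
    {m : SL(2, ℝ)}
    (hm : dist (m • UpperHalfPlane.I) (γ • m • UpperHalfPlane.I) = transLen γ) :
    (m⁻¹ * γ * m) 0 1 = (m⁻¹ * γ * m) 1 0 := by
  have hmin : ∀ m', frob (m⁻¹ * γ * m) ≤ frob (m'⁻¹ * γ * m') := by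
    intro m'
    rw [← two_cosh_dist_smul, ← two_cosh_dist_smul]
    have : cosh (dist (m • UpperHalfPlane.I) (γ • m • UpperHalfPlane.I)) ≤
        cosh (dist (m' • UpperHalfPlane.I) (γ • m' • UpperHalfPlane.I)) := by
      rw [cosh_le_cosh, abs_of_nonneg dist_nonneg, abs_of_nonneg dist_nonneg, hm]
      exact ciInf_le ⟨0, by rintro _ ⟨z, rfl⟩; exact dist_nonneg⟩ (m' • UpperHalfPlane.I)
    linarith
  have h3 := le_trace_sq_sub_two ((two_lt_two_mul_cosh ha).trans_le
    (two_cosh_le_frob_conj ha hbg hγ h1 h2 m)) hmin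
  rw [← trace_conj m] at h3
  have hd := det_eq (m⁻¹ * γ * m)
  unfold frob at h3
  nlinarith [sq_nonneg ((m⁻¹ * γ * m) 0 1 - (m⁻¹ * γ * m) 1 0)]

theorem frob_conj_le_of_dist_le {γ m : SL(2, ℝ)} {b : ℝ}
    (h : dist (m • UpperHalfPlane.I) (γ • m • UpperHalfPlane.I) ≤ b) :
    frob (m⁻¹ * γ * m) ≤ 2 * cosh b := by
  rw [← two_cosh_dist_smul]
  have : cosh (dist (m • UpperHalfPlane.I) (γ • m • UpperHalfPlane.I)) ≤ cosh b := by
    rw [cosh_le_cosh, abs_of_nonneg dist_nonneg]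
    exact h.trans (le_abs_self b)
  linarith

theorem exists_frob_le_of_isCompact {K : Set ℍ} (hK : IsCompact K) :
    ∃ M : ℝ, ∀ g : SL(2, ℝ), g • UpperHalfPlane.I ∈ K → frob g ≤ M := by
  obtain ⟨r, hr⟩ := hK.isBounded.subset_closedBall UpperHalfPlane.I
  refine ⟨2 * cosh r, fun g hg => ?_⟩
  have h1 := hr hg
  rw [Metric.mem_closedBall, dist_comm] at h1
  rw [← two_cosh_dist]
  have : cosh (dist UpperHalfPlane.I (g • UpperHalfPlane.I)) ≤ cosh r := by
    rw [cosh_le_cosh, abs_of_nonneg dist_nonneg]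
    exact h1.trans (le_abs_self r)
  linarith

theorem exists_isCompact_of_frob_le (M : ℝ) :
    ∃ K : Set ℍ, IsCompact K ∧ ∀ g : SL(2, ℝ), frob g ≤ M → g • UpperHalfPlane.I ∈ K := by
  refine ⟨Metric.closedBall UpperHalfPlane.I M, isCompact_closedBall _ _, fun g hg => ?_⟩
  rw [Metric.mem_closedBall, dist_comm]
  have h1 := two_cosh_dist g
  have h2 := Real.add_one_le_exp (dist UpperHalfPlane.I (g • UpperHalfPlane.I))
  rw [cosh_eq] at h1
  have h3 := exp_pos (-dist UpperHalfPlane.I (g • UpperHalfPlane.I))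
  linarith

/-- A geodesic ray staying in a compact region of the quotient, in terms of `frob`. -/
def BoundedRay (Γ : Subgroup SL(2, ℝ)) (g : SL(2, ℝ)) : Prop :=
  ∃ M : ℝ, ∀ t ≥ (0 : ℝ), ∃ γ ∈ Γ, frob (γ * (g * dMat t)) ≤ M

/-- A geodesic ray meeting closed geodesics of bounded length at arbitrarily large times, in terms
of conjugates of elements of `Γ`. -/
def CrossingRay (Γ : Subgroup SL(2, ℝ)) (D : ℝ) (g : SL(2, ℝ)) : Prop :=
  ∀ T : ℝ, ∃ t ≥ T, ∃ γ ∈ Γ, γ ≠ 1 ∧ γ ≠ negOne ∧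
    ((g * dMat t)⁻¹ * γ * (g * dMat t)) 0 1 = ((g * dMat t)⁻¹ * γ * (g * dMat t)) 1 0 ∧
    frob ((g * dMat t)⁻¹ * γ * (g * dMat t)) ≤ D

theorem exists_bounded_or_crossing {Γ : Subgroup SL(2, ℝ)} {a : ℝ} (ha : 0 < a)
    (hbg : BoundedGeomBelow Γ a) (hct : CoarselyTame Γ) :
    ∃ D : ℝ, ∀ g, BoundedRay Γ g ∨ CrossingRay Γ D g := by
  obtain ⟨-, b, -, h⟩ := hct
  refine ⟨2 * cosh b, fun g => ?_⟩
  rcases h g with ⟨K, hK, hg⟩ | hg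
  · left
    obtain ⟨M, hM⟩ := exists_frob_le_of_isCompact hK
    refine ⟨M, fun t ht => ?_⟩
    obtain ⟨γ, hγ, h1⟩ := hg t ht
    exact ⟨γ, hγ, hM _ (by rwa [mul_smul])⟩
  · right
    intro T
    obtain ⟨t, ht, γ, hγ, h1, h2, h3, h4⟩ := hg T
    exact ⟨t, ht, γ, hγ, h1, h2, conj_symm_of_dist_eq_transLen ha hbg hγ h1 h2 h3,
      frob_conj_le_of_dist_le (h3.trans_le h4)⟩

theorem not_bounded_of_coarselyTame {Γ : Subgroup SL(2, ℝ)} (hct : CoarselyTame Γ) :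
    ¬ ∃ M : ℝ, ∀ g : SL(2, ℝ), ∃ γ ∈ Γ, frob (γ * g) ≤ M := by
  rintro ⟨M, hM⟩
  obtain ⟨K, hK, hKM⟩ := exists_isCompact_of_frob_le M
  refine hct.1 ⟨K, hK, fun z => ?_⟩
  obtain ⟨γ, hγ, h⟩ := hM z.toSL2R
  refine ⟨γ, hγ, ?_⟩
  have := hKM _ h
  rwa [mul_smul, UpperHalfPlane.toSL2R_smul_I] at this

theorem exists_zpow_mul_add_inv_le (b : ℝ) (hb : 0 < b) (hb1 : b ≠ 1) :
    ∃ R : ℝ, ∀ y : ℝ, 0 < y → ∃ n : ℤ, b ^ n * y + (b ^ n * y)⁻¹ ≤ R := by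
  have main : ∀ b : ℝ, 1 < b → ∀ y : ℝ, 0 < y → ∃ n : ℤ, b ^ n * y + (b ^ n * y)⁻¹ ≤ b + 1 := by
    intro b hb y hy
    obtain ⟨n, hn1, hn2⟩ := exists_mem_Ico_zpow hy hb
    have hbn : 0 < b ^ n := by positivity
    refine ⟨-n, ?_⟩
    have e1 : 1 ≤ b ^ (-n) * y := by
      rw [_root_.zpow_neg, inv_mul_eq_div, le_div_iff₀ hbn]; linarith
    have e2 : b ^ (-n) * y ≤ b := by
      rw [_root_.zpow_neg, inv_mul_eq_div, div_le_iff₀ hbn]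
      rw [zpow_add_one₀ (by positivity)] at hn2; linarith
    exact add_le_add e2 (inv_le_one_of_one_le₀ e1)
  rcases lt_or_gt_of_ne hb1 with h | h
  · refine ⟨b⁻¹ + 1, fun y hy => ?_⟩
    obtain ⟨n, hn⟩ := main b⁻¹ ((one_lt_inv₀ hb).2 h) y hy
    exact ⟨-n, by simpa using hn⟩
  · exact ⟨b + 1, main b h⟩

theorem dMat_mul_dMat_neg (t : ℝ) : dMat t * dMat (-t) = 1 := by
  simpa using dMat_neg_mul (-t)

theorem frob_diagMat_mul_dMat (p : ℝˣ) (t : ℝ) :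
    frob (diagMat p * dMat t) = (p : ℝ) ^ 2 * exp t + ((p : ℝ) ^ 2 * exp t)⁻¹ := by
  have h : exp t = exp (t / 2) ^ 2 := by rw [← exp_nat_mul]; congr 1; push_cast; ring
  simp only [frob, mul_entry]
  simp [Real.exp_neg, h]
  ring

theorem frob_uMat (s : ℝ) : frob (uMat s) = 2 + s ^ 2 := by
  simp [frob]; ring

/-- A ray whose endpoint at infinity is fixed by a hyperbolic element of `Γ` is bounded. -/
theorem boundedRay_of_conj_upper {Γ : Subgroup SL(2, ℝ)} {γ x : SL(2, ℝ)} (hγ : γ ∈ Γ)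
    (h₁₀ : (x⁻¹ * γ * x) 1 0 = 0) (htr : 4 < (γ 0 0 + γ 1 1) ^ 2) : BoundedRay Γ x := by
  rw [← trace_conj x] at htr
  have hdet := det_eq (x⁻¹ * γ * x)
  obtain ⟨L, hL⟩ : ∃ L, L = x⁻¹ * γ * x := ⟨_, rfl⟩
  rw [← hL] at h₁₀ htr hdet
  rw [h₁₀, mul_zero, sub_zero] at hdet
  have hp0 : L 0 0 ≠ 0 := left_ne_zero_of_mul_eq_one hdet
  have hL11 : L 1 1 = (L 0 0)⁻¹ := eq_inv_of_mul_eq_one_right hdet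
  have hp1 : (L 0 0) ^ 2 ≠ 1 := by
    intro h
    have : (L 1 1) ^ 2 = 1 := by rw [hL11, inv_pow, h, inv_one]
    nlinarith
  obtain ⟨p, hp⟩ : ∃ p : ℝˣ, (p : ℝ) = L 0 0 := ⟨Units.mk0 _ hp0, rfl⟩
  obtain ⟨c, hc⟩ : ∃ c : ℝ, L 0 0 * c + L 0 1 = c * (L 0 0)⁻¹ := by
    refine ⟨L 0 1 * L 0 0 / (1 - L 0 0 ^ 2), ?_⟩
    have : 1 - L 0 0 ^ 2 ≠ 0 := sub_ne_zero.2 hp1.symm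
    field_simp
    ring
  have hconj : L * uMat c = uMat c * diagMat p := by
    apply ext_entry <;> simp only [mul_entry] <;> simp [h₁₀, hp, hL11, hc]
  have hγ' : γ = (x * uMat c) * diagMat p * (x * uMat c)⁻¹ := by
    rw [eq_mul_inv_iff_mul_eq, mul_assoc x, ← hconj, hL]; group
  obtain ⟨R, hR⟩ := exists_zpow_mul_add_inv_le (L 0 0 ^ 2) (by positivity) hp1
  refine ⟨frob (x * uMat c) * R * (2 + c ^ 2), fun t ht => ?_⟩
  obtain ⟨n, hn⟩ := hR (exp t) (exp_pos t)
  refine ⟨γ ^ n, zpow_mem hγ n, ?_⟩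
  have e1 : γ ^ n * (x * dMat t) =
      (x * uMat c) * (diagMat (p ^ n) * dMat t) * uMat (exp (-t) * (-c)) := by
    rw [hγ', conj_zpow, ← diagMat_zpow, ← dMat_mul_uMat_mul_dMat, neg_neg,
      _root_.mul_inv_rev, inv_uMat]
    simp only [mul_assoc]
    rw [← mul_assoc (dMat t) (dMat (-t)), dMat_mul_dMat_neg]
    simp
  rw [e1]
  have e2 : frob (diagMat (p ^ n) * dMat t) ≤ R := by
    rw [frob_diagMat_mul_dMat]
    have : ((p ^ n : ℝˣ) : ℝ) ^ 2 = (L 0 0 ^ 2) ^ n := by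
      rw [Units.val_zpow_eq_zpow_val, hp, ← zpow_natCast, ← zpow_natCast, zpow_comm]
    rwa [this]
  have e3 : frob (uMat (exp (-t) * (-c))) ≤ 2 + c ^ 2 := by
    rw [frob_uMat, mul_pow]
    have : exp (-t) ^ 2 ≤ 1 := pow_le_one₀ (exp_pos _).le (exp_le_one_iff.2 (by linarith))
    nlinarith [sq_nonneg c]
  have hR0 : 0 ≤ R := (frob_nonneg _).trans e2
  calc _ ≤ frob (x * uMat c * (diagMat (p ^ n) * dMat t)) * frob (uMat (exp (-t) * (-c))) :=
        frob_mul_le _ _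
    _ ≤ (frob (x * uMat c) * frob (diagMat (p ^ n) * dMat t)) *
        frob (uMat (exp (-t) * (-c))) :=
        mul_le_mul_of_nonneg_right (frob_mul_le _ _) (frob_nonneg _)
    _ ≤ frob (x * uMat c) * R * (2 + c ^ 2) := by
        have := frob_nonneg (x * uMat c)
        gcongr
        exact frob_nonneg _

/-- Every horocycle contains, in its positive half, a vector whose backward geodesic ray is
bounded. -/
theorem exists_pos_boundedRay_flip {Γ : Subgroup SL(2, ℝ)} {D : ℝ}
    (htr : ∀ γ ∈ Γ, γ ≠ 1 → γ ≠ negOne → 4 < (γ 0 0 + γ 1 1) ^ 2)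
    (hdich : ∀ g, BoundedRay Γ g ∨ CrossingRay Γ D g) (y : SL(2, ℝ)) :
    ∃ τ > 0, BoundedRay Γ (y * uMat τ * flip) := by
  rcases hdich (y * uMat 1 * flip) with h | h
  · exact ⟨1, one_pos, h⟩
  obtain ⟨t, ht, γ, hγ, h1, h2, hsymm, -⟩ := h 1
  obtain ⟨k, hk⟩ : ∃ k, k = (y * uMat 1)⁻¹ * γ * (y * uMat 1) := ⟨_, rfl⟩
  have hconj : (y * uMat 1 * flip * dMat t)⁻¹ * γ * (y * uMat 1 * flip * dMat t) =
      (dMat t)⁻¹ * flip⁻¹ * k * (flip * dMat t) := by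
    rw [hk]; group
  rw [hconj] at hsymm
  have hent : k 0 1 = k 1 0 * exp (-t) ^ 2 := by
    simp only [mul_entry, inv_entry₀₀, inv_entry₀₁, inv_entry₁₀, inv_entry₁₁] at hsymm
    simp at hsymm
    have e1 : exp (t / 2) * exp (-(t / 2)) = 1 := by rw [← exp_add]; simp
    have e2 : exp (-t) = exp (-(t / 2)) ^ 2 := by
      rw [← exp_nat_mul]; congr 1; push_cast; ring
    rw [e2]
    have : exp (t / 2) ^ 2 * k 0 1 = k 1 0 * exp (-(t / 2)) ^ 2 := by linarith
    linear_combination exp (-(t / 2)) ^ 2 * this -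
      k 0 1 * (exp (t / 2) * exp (-(t / 2)) + 1) * e1
  obtain ⟨e, he⟩ : ∃ e, e = exp (-t) := ⟨_, rfl⟩
  rw [← he] at hent
  have he0 : 0 < e := he ▸ exp_pos _
  have he1 : e < 1 := by rw [he, exp_lt_one_iff]; linarith
  obtain ⟨τ, hτ, hroot⟩ : ∃ τ ∈ Set.uIcc (-e) e,
      k 0 1 + (k 0 0 - k 1 1) * τ - k 1 0 * τ ^ 2 = 0 := by
    have hcont : ContinuousOn (fun τ => k 0 1 + (k 0 0 - k 1 1) * τ - k 1 0 * τ ^ 2)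
      (Set.uIcc (-e) e) := by fun_prop
    refine intermediate_value_uIcc hcont ?_
    rw [Set.mem_uIcc, hent]
    rcases le_total 0 ((k 0 0 - k 1 1) * e) with h | h
    · left; constructor <;> linarith
    · right; constructor <;> linarith
  rw [Set.uIcc_of_le (by linarith)] at hτ
  refine ⟨1 + τ, by linarith [hτ.1], boundedRay_of_conj_upper hγ ?_ (htr γ hγ h1 h2)⟩
  have hconj' : (y * uMat (1 + τ) * flip)⁻¹ * γ * (y * uMat (1 + τ) * flip) =
      flip⁻¹ * (uMat τ)⁻¹ * k * (uMat τ * flip) := by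
    rw [hk, ← uMat_mul]; group
  rw [hconj']
  simp only [mul_entry, inv_entry₀₀, inv_entry₀₁, inv_entry₁₀, inv_entry₁₁]
  simp
  linarith

/-- The positive half of the horocycle of `x` returns to a compact region of the quotient at
arbitrarily large times. -/
def Returns (Γ : Subgroup SL(2, ℝ)) (x : SL(2, ℝ)) : Prop :=
  ∃ M : ℝ, ∀ S : ℝ, ∃ s ≥ S, ∃ γ ∈ Γ, frob (γ * (x * uMat s)) ≤ M

theorem frob_dMat_conj_le {l : SL(2, ℝ)} (hl : l 0 1 = 0) {t : ℝ} (ht : 0 ≤ t) :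
    frob (dMat t * l * dMat (-t)) ≤ frob l := by
  have e1 : exp (t / 2) * exp (-(t / 2)) = 1 := by rw [← exp_add]; simp
  have e2 : exp (-(t / 2)) ^ 4 ≤ 1 :=
    pow_le_one₀ (exp_pos _).le (exp_le_one_iff.2 (by linarith))
  simp only [frob, mul_entry]
  simp [hl, neg_div]
  rw [show exp (t / 2) * l 0 0 * exp (-(t / 2)) = l 0 0 by linear_combination l 0 0 * e1,
    show exp (-(t / 2)) * l 1 1 * exp (t / 2) = l 1 1 by linear_combination l 1 1 * e1,
    show (exp (-(t / 2)) * l 1 0 * exp (-(t / 2))) ^ 2 = exp (-(t / 2)) ^ 4 * l 1 0 ^ 2 by ring]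
  nlinarith [sq_nonneg (l 1 0)]

theorem returns_of_boundedRay {Γ : Subgroup SL(2, ℝ)}
    (hflip : ∀ y : SL(2, ℝ), ∃ τ > 0, BoundedRay Γ (y * uMat τ * flip))
    {x : SL(2, ℝ)} (hx : BoundedRay Γ x) : Returns Γ x := by
  obtain ⟨M, hM⟩ := hx
  choose γ hγ hγM using fun n : ℕ => hM n n.cast_nonneg
  obtain ⟨y, -, hy⟩ := (isCompact_frob_le M).exists_mapClusterPt_of_frequently
    (l := atTop) (f := fun n : ℕ => γ n * (x * dMat n)) (Frequently.of_forall hγM)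
  obtain ⟨τ, hτ, M', hM'⟩ := hflip y
  obtain ⟨z, hz⟩ : ∃ z, z = y * uMat τ := ⟨_, rfl⟩
  rw [← hz] at hM'
  obtain ⟨φ, hφ⟩ : ∃ φ : SL(2, ℝ) → ℝ, φ = fun w => -(z⁻¹ * w) 0 1 / (z⁻¹ * w) 0 0 := ⟨_, rfl⟩
  have hzy : z⁻¹ * y = uMat (-τ) := by rw [hz, ← inv_uMat]; group
  have hc0 : Continuous fun w : SL(2, ℝ) => (z⁻¹ * w) 0 0 :=
    (continuous_entry 0 0).comp (continuous_const_mul z⁻¹)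
  have hc1 : Continuous fun w : SL(2, ℝ) => (z⁻¹ * w) 0 1 :=
    (continuous_entry 0 1).comp (continuous_const_mul z⁻¹)
  have hφc : ContinuousAt φ y := by
    rw [hφ]
    refine hc1.continuousAt.neg.div hc0.continuousAt ?_
    rw [hzy]; simp
  have hφy : φ y = τ := by rw [hφ]; simp only [hzy]; simp
  have hnhds : ∀ᶠ w in 𝓝 y, τ / 2 < φ w ∧ φ w < 2 * τ ∧ (z⁻¹ * w) 0 0 ≠ 0 := by
    refine (hφc.eventually (lt_mem_nhds (by rw [hφy]; linarith))).and
      ((hφc.eventually (gt_mem_nhds (by rw [hφy]; linarith))).and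
      (hc0.continuousAt.eventually_ne ?_))
    rw [hzy]; simp
  have hfreq := mapClusterPt_iff_frequently.1 hy _ hnhds
  refine ⟨M' * (frob z⁻¹ * M * (2 + (2 * τ) ^ 2)), fun S => ?_⟩
  have hlarge : ∀ᶠ n : ℕ in atTop, S ≤ exp n * (τ / 2) :=
    ((tendsto_exp_atTop.comp tendsto_natCast_atTop_atTop).atTop_mul_const
      (half_pos hτ)).eventually_ge_atTop S
  obtain ⟨n, ⟨h1, h2, h3⟩, hn⟩ := (hfreq.and_eventually hlarge).exists
  obtain ⟨w, hw⟩ : ∃ w, w = γ n * (x * dMat n) := ⟨_, rfl⟩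
  rw [← hw] at h1 h2 h3
  obtain ⟨δ, hδ, hδM⟩ := hM' n n.cast_nonneg
  refine ⟨exp n * φ w, hn.trans (by gcongr), δ * γ n, mul_mem hδ (hγ n), ?_⟩
  obtain ⟨l, hl⟩ : ∃ l, l = z⁻¹ * w * uMat (φ w) := ⟨_, rfl⟩
  have hl01 : l 0 1 = 0 := by
    rw [hl, mul_entry, uMat_entry₀₁, uMat_entry₁₁, hφ]
    field_simp
    ring
  have e1 : δ * γ n * (x * uMat (exp n * φ w)) =
      δ * z * dMat (-n) * (dMat n * l * dMat (-n)) := by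
    rw [← dMat_mul_uMat_mul_dMat, hl, hw]
    have := dMat_neg_mul n
    calc _ = δ * (γ n * (x * dMat n) * uMat (φ w)) * dMat (-n) := by
          rw [hw]; group
      _ = δ * z * (dMat (-n) * dMat n) * z⁻¹ * (γ n * (x * dMat n) * uMat (φ w)) * dMat (-n) := by
          rw [this]; group
      _ = _ := by rw [hw]; group
  have e2 : frob (δ * z * dMat (-n)) ≤ M' := by
    rw [← frob_mul_flip]
    calc _ = frob (δ * (z * flip * dMat n)) := by
          rw [mul_assoc (δ * z), ← flip_mul_dMat]; simp only [mul_assoc]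
      _ ≤ M' := hδM
  have e3 : frob l ≤ frob z⁻¹ * M * (2 + (2 * τ) ^ 2) := by
    have hwM : frob w ≤ M := hw ▸ hγM n
    have hM0 : 0 ≤ M := (frob_nonneg _).trans hwM
    have hz0 := frob_nonneg z⁻¹
    calc frob l ≤ frob (z⁻¹ * w) * frob (uMat (φ w)) := hl ▸ frob_mul_le _ _
      _ ≤ (frob z⁻¹ * frob w) * frob (uMat (φ w)) :=
          mul_le_mul_of_nonneg_right (frob_mul_le _ _) (frob_nonneg _)
      _ ≤ frob z⁻¹ * M * (2 + (2 * τ) ^ 2) := by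
          rw [frob_uMat]
          have : 0 ≤ φ w := by linarith
          gcongr
  rw [e1]
  exact (frob_mul_le _ _).trans (mul_le_mul e2
    ((frob_dMat_conj_le hl01 n.cast_nonneg).trans e3) (frob_nonneg _)
    ((frob_nonneg _).trans e2))

theorem negOne_entry (i j : Fin 2) : negOne i j = -(1 : SL(2, ℝ)) i j := by
  fin_cases i <;> fin_cases j <;> simp [negOne]

theorem mul_negOne_entry (g : SL(2, ℝ)) (i j : Fin 2) : (g * negOne) i j = -g i j := by
  rw [mul_entry, negOne_entry, negOne_entry]
  fin_cases j <;> simp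

theorem negOne_mul_entry (g : SL(2, ℝ)) (i j : Fin 2) : (negOne * g) i j = -g i j := by
  rw [mul_entry, negOne_entry, negOne_entry]
  fin_cases i <;> simp

/-- Entries of the conjugate by `x` in terms of those of the conjugate by `x * dMat t`. -/
theorem conj_entries (x γ : SL(2, ℝ)) (t : ℝ) :
    (x⁻¹ * γ * x) 0 0 = ((x * dMat t)⁻¹ * γ * (x * dMat t)) 0 0 ∧
    (x⁻¹ * γ * x) 1 0 = ((x * dMat t)⁻¹ * γ * (x * dMat t)) 1 0 * exp (-t) ∧
    (x⁻¹ * γ * x) 1 1 = ((x * dMat t)⁻¹ * γ * (x * dMat t)) 1 1 := by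
  have hconj : (x * dMat t)⁻¹ * γ * (x * dMat t) = (dMat t)⁻¹ * (x⁻¹ * γ * x) * dMat t := by group
  have e1 : exp (t / 2) * exp (-(t / 2)) = 1 := by rw [← exp_add]; simp
  have e2 : exp (-t) = exp (-(t / 2)) ^ 2 := by rw [← exp_nat_mul]; congr 1; push_cast; ring
  rw [hconj]
  generalize x⁻¹ * γ * x = k
  rw [e2]
  simp only [mul_entry, inv_entry₀₀, inv_entry₀₁, inv_entry₁₀, inv_entry₁₁]
  simp
  refine ⟨?_, ?_, ?_⟩
  · linear_combination -k 0 0 * e1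
  · linear_combination -k 1 0 * (exp (t / 2) * exp (-(t / 2)) + 1) * e1
  · linear_combination -k 1 1 * e1

theorem mul_uMat_entries {k : SL(2, ℝ)} (hk : k 0 0 ≠ 0) :
    (k * uMat (-k 0 1 / k 0 0)) 0 0 = k 0 0 ∧ (k * uMat (-k 0 1 / k 0 0)) 0 1 = 0 ∧
    (k * uMat (-k 0 1 / k 0 0)) 1 0 = k 1 0 ∧ (k * uMat (-k 0 1 / k 0 0)) 1 1 = (k 0 0)⁻¹ := by
  have hd := det_eq k
  simp only [mul_entry]
  simp
  constructor
  · field_simp; ring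
  · field_simp; linarith

theorem frob_mul_uMat {k : SL(2, ℝ)} (hk : k 0 0 ≠ 0) :
    frob (k * uMat (-k 0 1 / k 0 0)) = k 0 0 ^ 2 + k 1 0 ^ 2 + ((k 0 0)⁻¹) ^ 2 := by
  obtain ⟨h1, h2, h3, h4⟩ := mul_uMat_entries hk
  rw [frob, h1, h2, h3, h4]; ring

theorem continuous_frob_inv_mul :
    Continuous fun q : SL(2, ℝ) × SL(2, ℝ) => frob (q.1⁻¹ * q.2) := by
  refine continuous_frob.comp (continuous_of_entry fun i j => ?_)
  simp only [mul_entry]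
  have h1 : ∀ i j, Continuous fun q : SL(2, ℝ) × SL(2, ℝ) => q.1⁻¹ i j := fun i j =>
    (continuous_entry i j).comp (continuous_inv.comp continuous_fst)
  have h2 : ∀ i j, Continuous fun q : SL(2, ℝ) × SL(2, ℝ) => q.2 i j := fun i j =>
    (continuous_entry i j).comp continuous_snd
  exact ((h1 _ _).mul (h2 _ _)).add ((h1 _ _).mul (h2 _ _))

theorem exists_nhds_frob_inv_mul_lt (g : SL(2, ℝ)) {A : ℝ} (hA : 2 < A) :
    ∃ W ∈ 𝓝 g, ∀ v ∈ W, ∀ w ∈ W, frob (v⁻¹ * w) < A := by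
  have hopen : IsOpen {q : SL(2, ℝ) × SL(2, ℝ) | frob (q.1⁻¹ * q.2) < A} :=
    isOpen_lt continuous_frob_inv_mul continuous_const
  have hmem : (g, g) ∈ {q : SL(2, ℝ) × SL(2, ℝ) | frob (q.1⁻¹ * q.2) < A} := by
    simpa [frob_one] using hA
  obtain ⟨U, V, hU, hV, hgU, hgV, hsub⟩ := isOpen_prod_iff.1 hopen g g hmem
  have h : ∀ v ∈ U ∩ V, ∀ w ∈ U ∩ V, frob (v⁻¹ * w) < A := fun v hv w hw => by
    have := hsub (Set.mk_mem_prod hv.1 hw.2)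
    exact this
  exact ⟨U ∩ V, inter_mem (hU.mem_nhds hgU) (hV.mem_nhds hgV), h⟩

/-- If along a ray crossing short closed geodesics the horocycle escapes, then the corresponding
elements of `Γ` stay bounded. -/
theorem frob_conj_le_of_escape {Γ : Subgroup SL(2, ℝ)} {x γ : SL(2, ℝ)} {D S t : ℝ} (ht : 0 ≤ t)
    (hesc : ∀ s ≥ S, ∀ γ ∈ Γ, frob x * (2 * D) < frob (γ * (x * uMat s))) (hγ : γ ∈ Γ)
    (hsymm : ((x * dMat t)⁻¹ * γ * (x * dMat t)) 0 1 = ((x * dMat t)⁻¹ * γ * (x * dMat t)) 1 0)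
    (hD : frob ((x * dMat t)⁻¹ * γ * (x * dMat t)) ≤ D) :
    frob (x⁻¹ * γ * x) ≤ D + D * S ^ 2 := by
  obtain ⟨e00, e10, e11⟩ := conj_entries x γ t
  have hdh := det_eq ((x * dMat t)⁻¹ * γ * (x * dMat t))
  have hexp : exp (-t) ^ 2 ≤ 1 := pow_le_one₀ (exp_pos _).le (exp_le_one_iff.2 (by linarith))
  rw [hsymm, ← e00, ← e11] at hdh
  obtain ⟨k, hk⟩ : ∃ k, k = x⁻¹ * γ * x := ⟨_, rfl⟩
  unfold frob at hD
  rw [hsymm, ← e00, ← e11] at hD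
  rw [← hk] at hdh hD e10 ⊢
  generalize ((x * dMat t)⁻¹ * γ * (x * dMat t)) 1 0 = q at *
  have h10 : k 1 0 ^ 2 ≤ q ^ 2 := by rw [e10, mul_pow]; nlinarith [sq_nonneg q]
  have hps : 1 ≤ k 0 0 * k 1 1 := by nlinarith [sq_nonneg q]
  have key : ∀ k γ : SL(2, ℝ), γ ∈ Γ → k = x⁻¹ * γ * x → 1 ≤ k 0 0 * k 1 1 →
      k 0 0 ^ 2 + k 1 0 ^ 2 + k 1 1 ^ 2 ≤ D → -k 0 1 / k 0 0 < S := by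
    intro k γ hγ hk hps hD
    by_contra! hcon
    have h0 : k 0 0 ≠ 0 := by rintro h; rw [h] at hps; norm_num at hps
    have h1 := hesc _ hcon γ hγ
    have h2 : γ * (x * uMat (-k 0 1 / k 0 0)) = x * (k * uMat (-k 0 1 / k 0 0)) := by
      nth_rewrite 3 [hk]; group
    have h3 := frob_mul_le x (k * uMat (-k 0 1 / k 0 0))
    rw [← h2, frob_mul_uMat h0] at h3
    have h4 : ((k 0 0)⁻¹) ^ 2 ≤ k 1 1 ^ 2 := by
      rw [inv_pow, inv_le_iff_one_le_mul₀ (by positivity)]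
      nlinarith
    have h5 : frob x * (k 0 0 ^ 2 + k 1 0 ^ 2 + ((k 0 0)⁻¹) ^ 2) ≤ frob x * (2 * D) :=
      mul_le_mul_of_nonneg_left (by nlinarith [sq_nonneg (k 0 0), sq_nonneg (k 1 0)])
        (frob_nonneg x)
    linarith
  have h1 := key k γ hγ hk hps (by nlinarith [sq_nonneg q])
  have h2 := key k⁻¹ γ⁻¹ (inv_mem hγ) (by rw [hk]; group) (by simpa [mul_comm] using hps)
    (by simp; nlinarith [sq_nonneg q])
  simp at h2
  have h01 : k 0 1 ^ 2 ≤ D * S ^ 2 := by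
    have hs : ∀ c u v : ℝ, u ^ 2 + v ^ 2 ≤ D → 0 < u → 0 < v → -c < S * u → c < S * v →
        c ^ 2 ≤ D * S ^ 2 := by
      intro c u v huv hu hv h1 h2
      rcases le_total 0 c with hc | hc
      · have : c ^ 2 ≤ (S * v) ^ 2 := pow_le_pow_left₀ hc h2.le 2
        nlinarith [mul_nonneg (sq_nonneg S) (sq_nonneg u)]
      · have : (-c) ^ 2 ≤ (S * u) ^ 2 := pow_le_pow_left₀ (by linarith) h1.le 2
        nlinarith [mul_nonneg (sq_nonneg S) (sq_nonneg v)]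
    have hD' : k 0 0 ^ 2 + k 1 1 ^ 2 ≤ D := by nlinarith [sq_nonneg q]
    rcases lt_trichotomy (k 0 0) 0 with h | h | h
    · have h' : k 1 1 < 0 := by nlinarith
      rw [div_lt_iff_of_neg h] at h1
      rw [div_lt_iff_of_neg h'] at h2
      have := hs (-k 0 1) (-k 0 0) (-k 1 1) (by nlinarith) (by linarith) (by linarith)
        (by linarith) (by linarith)
      simpa using this
    · rw [h] at hps; norm_num at hps
    · have h' : 0 < k 1 1 := by nlinarith
      rw [div_lt_iff₀ h] at h1
      rw [div_lt_iff₀ h'] at h2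
      exact hs _ _ _ hD' h h' h1 h2
  unfold frob
  nlinarith [sq_nonneg q]

theorem returns_of_crossingRay {Γ : Subgroup SL(2, ℝ)} {a D : ℝ} (ha : 0 < a)
    (hbg : BoundedGeomBelow Γ a)
    (htr : ∀ γ ∈ Γ, γ ≠ 1 → γ ≠ negOne → 4 < (γ 0 0 + γ 1 1) ^ 2)
    {x : SL(2, ℝ)} (hbr : BoundedRay Γ x → Returns Γ x) (hx : CrossingRay Γ D x) :
    Returns Γ x := by
  by_contra hnr
  have hesc := hnr
  unfold Returns at hesc
  push Not at hesc
  obtain ⟨S, hS⟩ := hesc (frob x * (2 * D))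
  choose t ht γ hγ h1 h2 hsymm hD using fun n : ℕ => hx n
  have ht0 : ∀ n, 0 ≤ t n := fun n => n.cast_nonneg.trans (ht n)
  have hbd : ∀ n, frob (γ n) ≤ frob x * (D + D * S ^ 2) * frob x⁻¹ := by
    intro n
    have h3 := frob_conj_le_of_escape (ht0 n) hS (hγ n) (hsymm n) (hD n)
    calc frob (γ n) = frob (x * (x⁻¹ * γ n * x) * x⁻¹) := by congr 1; group
      _ ≤ frob (x * (x⁻¹ * γ n * x)) * frob x⁻¹ := frob_mul_le _ _
      _ ≤ frob x * frob (x⁻¹ * γ n * x) * frob x⁻¹ :=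
          mul_le_mul_of_nonneg_right (frob_mul_le _ _) (frob_nonneg _)
      _ ≤ _ := mul_le_mul_of_nonneg_right
          (mul_le_mul_of_nonneg_left h3 (frob_nonneg _)) (frob_nonneg _)
  obtain ⟨g, -, hg⟩ := (isCompact_frob_le _).exists_mapClusterPt_of_frequently
    (l := atTop) (f := γ) (Frequently.of_forall hbd)
  obtain ⟨W, hW, hWlt⟩ := exists_nhds_frob_inv_mul_lt g (two_lt_two_mul_cosh ha)
  have hfreq := mapClusterPt_iff_frequently.1 hg W hW
  obtain ⟨m, hm⟩ := hfreq.exists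
  have hent : ∀ n, γ n ∈ W → (x⁻¹ * γ m * x) 1 0 ^ 2 ≤ D * exp (-n) := by
    intro n hn
    have h10 : (x⁻¹ * γ n * x) 1 0 ^ 2 = (x⁻¹ * γ m * x) 1 0 ^ 2 := by
      by_cases hone : (γ m)⁻¹ * γ n = 1
      · rw [inv_mul_eq_one.1 hone]
      · by_cases hneg : (γ m)⁻¹ * γ n = negOne
        · have hn' : γ n = γ m * negOne := by rw [← hneg]; group
          have hcomm : x⁻¹ * γ n * x = x⁻¹ * γ m * x * negOne := by
            rw [hn']
            apply ext_entry <;> simp only [mul_entry, negOne_entry] <;> simp <;> ring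
          rw [hcomm, mul_negOne_entry, neg_sq]
        · have := two_cosh_le_frob_conj ha hbg (mul_mem (inv_mem (hγ m)) (hγ n)) hone hneg 1
          have h4 := hWlt _ hm _ hn
          simp only [inv_one, one_mul, mul_one] at this
          linarith
    rw [← h10, (conj_entries x (γ n) (t n)).2.1, mul_pow]
    have hq : ((x * dMat (t n))⁻¹ * γ n * (x * dMat (t n))) 1 0 ^ 2 ≤ D := by
      refine le_trans ?_ (hD n)
      unfold frob
      nlinarith [sq_nonneg (((x * dMat (t n))⁻¹ * γ n * (x * dMat (t n))) 0 0),
        sq_nonneg (((x * dMat (t n))⁻¹ * γ n * (x * dMat (t n))) 0 1),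
        sq_nonneg (((x * dMat (t n))⁻¹ * γ n * (x * dMat (t n))) 1 1)]
    have he : exp (-t n) ^ 2 ≤ exp (-n) := by
      rw [← exp_nat_mul]
      apply exp_le_exp.2
      push_cast
      linarith [ht n, ht0 n]
    exact mul_le_mul hq he (sq_nonneg _) ((sq_nonneg _).trans hq)
  have hlim : Tendsto (fun n : ℕ => D * exp (-n)) atTop (𝓝 0) := by
    have := (tendsto_exp_neg_atTop_nhds_zero.comp tendsto_natCast_atTop_atTop).const_mul D
    simpa using this
  have hzero : (x⁻¹ * γ m * x) 1 0 ^ 2 ≤ 0 := by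
    by_contra! hpos
    obtain ⟨n, hn, hn'⟩ := (hfreq.and_eventually (hlim.eventually (gt_mem_nhds hpos))).exists
    exact absurd (hent n hn) (not_le.2 hn')
  exact hnr (hbr (boundedRay_of_conj_upper (hγ m)
    (pow_eq_zero_iff two_ne_zero |>.1 (le_antisymm hzero (sq_nonneg _)))
    (htr _ (hγ m) (h1 m) (h2 m))))

theorem returns_of_coarselyTame {Γ : Subgroup SL(2, ℝ)} {a : ℝ} (ha : 0 < a)
    (hbg : BoundedGeomBelow Γ a) (hct : CoarselyTame Γ) (x : SL(2, ℝ)) : Returns Γ x := by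
  obtain ⟨D, hD⟩ := exists_bounded_or_crossing ha hbg hct
  have htr : ∀ γ ∈ Γ, γ ≠ 1 → γ ≠ negOne → 4 < (γ 0 0 + γ 1 1) ^ 2 := fun γ hγ h1 h2 => by
    linarith [two_cosh_le_trace_sq ha hbg hγ h1 h2, two_lt_two_mul_cosh ha]
  have hbr : BoundedRay Γ x → Returns Γ x :=
    returns_of_boundedRay (exists_pos_boundedRay_flip htr hD)
  exact (hD x).elim hbr (returns_of_crossingRay ha hbg htr hbr)

theorem frob_negOne_mul (g : SL(2, ℝ)) : frob (negOne * g) = frob g := by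
  simp only [frob, negOne_mul_entry]; ring

theorem exists_nontrivial {Γ : Subgroup SL(2, ℝ)} {D : ℝ}
    (hdich : ∀ g, BoundedRay Γ g ∨ CrossingRay Γ D g) : ∃ δ ∈ Γ, δ ≠ 1 ∧ δ ≠ negOne := by
  rcases hdich 1 with ⟨M, hM⟩ | h
  · by_contra! hcon
    obtain ⟨γ, hγ, h⟩ := hM |M| (abs_nonneg M)
    have h1 : frob (γ * (1 * dMat |M|)) = frob (diagMat 1 * dMat |M|) := by
      have h2 : diagMat 1 = 1 := by apply ext_entry <;> simp
      rw [h2]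
      by_cases h3 : γ = 1
      · rw [h3, one_mul]
      · rw [hcon γ hγ h3, frob_negOne_mul]
    rw [h1, frob_diagMat_mul_dMat] at h
    have h4 := add_one_le_exp |M|
    have h5 := inv_pos.2 (exp_pos |M|)
    simp only [Units.val_one, one_pow, one_mul] at h
    linarith [le_abs_self M]
  · obtain ⟨-, -, γ, hγ, h1, h2, -⟩ := h 0
    exact ⟨γ, hγ, h1, h2⟩

/-- At arbitrarily large times along a ray there are elements of `Γ` of bounded displacement,
which can be chosen to expand the direction of the ray by a definite amount. -/
theorem exists_bounded_expanding {Γ : Subgroup SL(2, ℝ)} {a : ℝ} (ha : 0 < a)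
    (hbg : BoundedGeomBelow Γ a) (hct : CoarselyTame Γ) (g : SL(2, ℝ)) :
    ∃ D : ℝ, ∀ T ≥ (0 : ℝ), ∃ t ≥ T, ∃ γ ∈ Γ,
      (cosh a + 1) / 2 ≤ ((g * dMat t)⁻¹ * γ * (g * dMat t)) 0 0 ^ 2 ∧
      frob ((g * dMat t)⁻¹ * γ * (g * dMat t)) ≤ D := by
  obtain ⟨D, hD⟩ := exists_bounded_or_crossing ha hbg hct
  have loops : ∃ D : ℝ, ∀ T ≥ (0 : ℝ), ∃ t ≥ T, ∃ γ ∈ Γ, γ ≠ 1 ∧ γ ≠ negOne ∧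
      frob ((g * dMat t)⁻¹ * γ * (g * dMat t)) ≤ D := by
    rcases hD g with ⟨M, hM⟩ | h
    · obtain ⟨δ, hδ, h1, h2⟩ := exists_nontrivial hD
      refine ⟨M * frob δ * M, fun T hT => ⟨T, le_rfl, ?_⟩⟩
      obtain ⟨γ, hγ, h⟩ := hM T hT
      have hneg : ∀ m : SL(2, ℝ), m⁻¹ * negOne * m = negOne := fun m => by
        rw [mul_assoc, inv_mul_eq_iff_eq_mul]
        ext i j
        rw [negOne_mul_entry, mul_negOne_entry]
      refine ⟨γ⁻¹ * δ * γ, mul_mem (mul_mem (inv_mem hγ) hδ) hγ, fun h3 => h1 ?_,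
        fun h3 => h2 ?_, ?_⟩
      · have : δ = γ * (γ⁻¹ * δ * γ) * γ⁻¹ := by group
        rw [this, h3]; group
      · have : δ = γ * (γ⁻¹ * δ * γ) * γ⁻¹ := by group
        rw [this, h3]
        simpa using hneg γ⁻¹
      · have hM0 : 0 ≤ M := (frob_nonneg _).trans h
        calc frob ((g * dMat T)⁻¹ * (γ⁻¹ * δ * γ) * (g * dMat T))
            = frob ((γ * (g * dMat T))⁻¹ * δ * (γ * (g * dMat T))) := by congr 1; group
          _ ≤ frob ((γ * (g * dMat T))⁻¹ * δ) * frob (γ * (g * dMat T)) := frob_mul_le _ _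
          _ ≤ frob (γ * (g * dMat T))⁻¹ * frob δ * frob (γ * (g * dMat T)) :=
              mul_le_mul_of_nonneg_right (frob_mul_le _ _) (frob_nonneg _)
          _ ≤ M * frob δ * M := by
              rw [frob_inv]
              have := frob_nonneg δ
              have := frob_nonneg (γ * (g * dMat T))
              gcongr
    · refine ⟨D, fun T _ => ?_⟩
      obtain ⟨t, ht, γ, hγ, h1, h2, -, h3⟩ := h T
      exact ⟨t, ht, γ, hγ, h1, h2, h3⟩
  obtain ⟨D, hD⟩ := loops
  refine ⟨D, fun T hT => ?_⟩
  obtain ⟨t, ht, γ, hγ, h1, h2, h3⟩ := hD T hT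
  have htr := two_cosh_le_trace_sq ha hbg hγ h1 h2
  rw [← trace_conj (g * dMat t)] at htr
  have hinv : (g * dMat t)⁻¹ * γ⁻¹ * (g * dMat t) = ((g * dMat t)⁻¹ * γ * (g * dMat t))⁻¹ := by
    group
  refine ⟨t, ht, ?_⟩
  by_cases h : (cosh a + 1) / 2 ≤ ((g * dMat t)⁻¹ * γ * (g * dMat t)) 0 0 ^ 2
  · exact ⟨γ, hγ, h, h3⟩
  · refine ⟨γ⁻¹, inv_mem hγ, ?_, ?_⟩
    · rw [hinv, inv_entry₀₀]
      nlinarith [sq_nonneg (((g * dMat t)⁻¹ * γ * (g * dMat t)) 0 0 -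
        ((g * dMat t)⁻¹ * γ * (g * dMat t)) 1 1)]
    · rw [hinv, frob_inv]; exact h3

/-- A minimal set of the horocycle flow on `Γ \ SL(2,ℝ)`, lifted to `SL(2,ℝ)`. -/
structure IsHorocycleMinimal (Γ : Subgroup SL(2, ℝ)) (C : Set SL(2, ℝ)) : Prop where
  nonempty : C.Nonempty
  isClosed : IsClosed C
  mul_left : ∀ γ ∈ Γ, ∀ x ∈ C, γ * x ∈ C
  mul_uMat : ∀ s : ℝ, ∀ x ∈ C, x * uMat s ∈ C
  minimal : ∀ P : Set SL(2, ℝ), P ⊆ C → P.Nonempty → IsClosed P → (∀ γ ∈ Γ, ∀ x ∈ P, γ * x ∈ P) →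
    (∀ s : ℝ, ∀ x ∈ P, x * uMat s ∈ P) → C ⊆ P

namespace IsHorocycleMinimal

variable {Γ : Subgroup SL(2, ℝ)} {C : Set SL(2, ℝ)}

theorem mul_diagMat_mem (hC : IsHorocycleMinimal Γ C) {p : ℝˣ} {g : SL(2, ℝ)} (hg : g ∈ C)
    (hgp : g * diagMat p ∈ C) : ∀ x ∈ C, x * diagMat p ∈ C := by
  have := hC.minimal {x | x ∈ C ∧ x * diagMat p ∈ C} (fun x hx => hx.1) ⟨g, hg, hgp⟩
    (hC.isClosed.inter (hC.isClosed.preimage (continuous_mul_const _)))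
    (fun γ hγ x hx => ⟨hC.mul_left γ hγ x hx.1, by
      rw [mul_assoc]; exact hC.mul_left γ hγ _ hx.2⟩)
    (fun s x hx => ⟨hC.mul_uMat s x hx.1, by
      rw [mul_assoc, uMat_mul_diagMat, ← mul_assoc]; exact hC.mul_uMat _ _ hx.2⟩)
  exact fun x hx => (this hx).2

/-- A minimal set is invariant under a nontrivial discrete time of the geodesic flow. -/
theorem exists_diagMat (hC : IsHorocycleMinimal Γ C) {a : ℝ} (ha : 0 < a)
    (hbg : BoundedGeomBelow Γ a) (hct : CoarselyTame Γ) :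
    ∃ p : ℝˣ, (p : ℝ) ^ 2 ≠ 1 ∧ ∀ n : ℤ, ∀ x ∈ C, x * diagMat (p ^ n) ∈ C := by
  obtain ⟨g, hg⟩ := hC.nonempty
  obtain ⟨D, hD⟩ := exists_bounded_expanding ha hbg hct g
  choose t ht γ hγ hp hfr using fun n : ℕ => hD n n.cast_nonneg
  have hκ : 1 < (cosh a + 1) / 2 := by linarith [two_lt_two_mul_cosh ha]
  obtain ⟨k, hk⟩ : ∃ k : ℕ → SL(2, ℝ), ∀ n, k n = g⁻¹ * γ n * g := ⟨_, fun n => rfl⟩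
  have hk00 : ∀ n, (cosh a + 1) / 2 ≤ k n 0 0 ^ 2 := fun n => by
    rw [hk, (conj_entries g (γ n) (t n)).1]; exact hp n
  have hkD : ∀ n, k n 0 0 ^ 2 ≤ D := fun n => by
    rw [hk, (conj_entries g (γ n) (t n)).1]
    refine le_trans ?_ (hfr n)
    unfold frob
    rw [add_assoc, add_assoc]
    exact le_add_of_nonneg_right (by positivity)
  have hD0 : 0 ≤ D := (sq_nonneg _).trans (hkD 0)
  have hk10 : ∀ n : ℕ, k n 1 0 ^ 2 ≤ D * exp (-n) := fun n => by
    rw [hk, (conj_entries g (γ n) (t n)).2.1, mul_pow]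
    refine mul_le_mul ?_ ?_ (by positivity) hD0
    · refine le_trans ?_ (hfr n)
      unfold frob
      refine le_add_of_le_of_nonneg (le_add_of_nonneg_left (by positivity)) (sq_nonneg _)
    · rw [← exp_nat_mul]
      apply exp_le_exp.2
      push_cast
      linarith [ht n, (n.cast_nonneg : (0 : ℝ) ≤ n)]
  have hk0 : ∀ n, k n 0 0 ≠ 0 := fun n h => by
    have := hk00 n
    rw [h] at this; norm_num at this; linarith
  obtain ⟨v, hv⟩ : ∃ v : ℕ → SL(2, ℝ), ∀ n, v n = k n * uMat (-k n 0 1 / k n 0 0) :=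
    ⟨_, fun n => rfl⟩
  have hvC : ∀ n, g * v n ∈ C := fun n => by
    have : g * v n = γ n * g * uMat (-k n 0 1 / k n 0 0) := by
      rw [hv]; nth_rewrite 1 [hk]; group
    rw [this]
    exact hC.mul_uMat _ _ (hC.mul_left _ (hγ n) _ hg)
  have hvent := fun n => mul_uMat_entries (hk0 n)
  simp only [← hv] at hvent
  have hvfr : ∀ n, frob (v n) ≤ D + D + 1 := fun n => by
    rw [hv, frob_mul_uMat (hk0 n)]
    have h1 : (k n 0 0)⁻¹ ^ 2 ≤ 1 := by
      rw [inv_pow]; exact inv_le_one_of_one_le₀ (hκ.le.trans (hk00 n))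
    have h2 : D * exp (-n) ≤ D :=
      mul_le_of_le_one_right hD0 (exp_le_one_iff.2 (neg_nonpos.2 n.cast_nonneg))
    linarith [hkD n, hk10 n]
  obtain ⟨w, -, hw⟩ := (isCompact_frob_le _).exists_mapClusterPt_of_frequently
    (l := atTop) (f := v) (Frequently.of_forall hvfr)
  have hwC : g * w ∈ C :=
    (hC.isClosed.preimage (continuous_const_mul g)).mem_of_mapClusterPt hw
      (Eventually.of_forall hvC)
  have hw01 : w 0 1 = 0 :=
    (isClosed_eq (continuous_entry 0 1) continuous_const).mem_of_mapClusterPt hw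
      (Eventually.of_forall fun n => (hvent n).2.1)
  have hw00 : (cosh a + 1) / 2 ≤ w 0 0 ^ 2 :=
    (isClosed_le continuous_const ((continuous_entry 0 0).pow 2)).mem_of_mapClusterPt hw
      (Eventually.of_forall fun n => by
        show _ ≤ v n 0 0 ^ 2
        rw [(hvent n).1]; exact hk00 n)
  have hlim : Tendsto (fun n : ℕ => D * exp (-n)) atTop (𝓝 0) := by
    have := (tendsto_exp_neg_atTop_nhds_zero.comp tendsto_natCast_atTop_atTop).const_mul D
    simpa using this
  have hw10 : w 1 0 ^ 2 ≤ 0 := by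
    refine le_of_forall_pos_le_add fun ε hε => ?_
    rw [zero_add]
    refine (isClosed_le ((continuous_entry 1 0).pow 2) continuous_const).mem_of_mapClusterPt hw ?_
    filter_upwards [hlim.eventually (gt_mem_nhds hε)] with n hn
    show v n 1 0 ^ 2 ≤ ε
    rw [(hvent n).2.2.1]
    exact (hk10 n).trans hn.le
  have hw10' : w 1 0 = 0 := pow_eq_zero_iff two_ne_zero |>.1 (le_antisymm hw10 (sq_nonneg _))
  have hdet := det_eq w
  rw [hw01, zero_mul, sub_zero] at hdet
  obtain ⟨p, hp⟩ : ∃ p : ℝˣ, (p : ℝ) = w 0 0 :=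
    ⟨Units.mk0 _ (left_ne_zero_of_mul_eq_one hdet), rfl⟩
  have hwp : w = diagMat p := by
    apply ext_entry <;> simp [hp, hw01, hw10']
    exact eq_inv_of_mul_eq_one_right hdet
  rw [hwp] at hwC
  have hinv : diagMat p * diagMat p⁻¹ = 1 := by
    rw [← diagMat_mul, mul_inv_cancel]; apply ext_entry <;> simp
  have h1 := hC.mul_diagMat_mem hg hwC
  have h2 := hC.mul_diagMat_mem (p := p⁻¹) hwC (by rwa [mul_assoc, hinv, mul_one])
  refine ⟨p, by rw [hp]; linarith, fun n => ?_⟩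
  have hpow : ∀ q : ℝˣ, (∀ x ∈ C, x * diagMat q ∈ C) → ∀ n : ℕ, ∀ x ∈ C,
      x * diagMat (q ^ n) ∈ C := by
    intro q hq n
    induction n with
    | zero =>
      intro x hx
      have : diagMat 1 = 1 := by apply ext_entry <;> simp
      rwa [pow_zero, this, mul_one]
    | succ n ih =>
      intro x hx
      rw [pow_succ, diagMat_mul, ← mul_assoc]
      exact hq _ (ih x hx)
  obtain ⟨m, rfl | rfl⟩ := n.eq_nat_or_neg
  · rw [zpow_natCast]; exact hpow p h1 m
  · rw [_root_.zpow_neg, zpow_natCast, ← inv_pow]; exact hpow p⁻¹ h2 m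

/-- A minimal set is unbounded modulo `Γ`. -/
theorem not_bounded (hC : IsHorocycleMinimal Γ C) {a : ℝ} (ha : 0 < a)
    (hbg : BoundedGeomBelow Γ a) (hct : CoarselyTame Γ) :
    ¬ ∃ M : ℝ, ∀ x ∈ C, ∃ γ ∈ Γ, frob (γ * x) ≤ M := by
  rintro ⟨M, hM⟩
  obtain ⟨p, hp1, hp⟩ := hC.exists_diagMat ha hbg hct
  obtain ⟨g₀, hg₀⟩ := hC.nonempty
  obtain ⟨R, hR⟩ := exists_zpow_mul_add_inv_le ((p : ℝ) ^ 2) (sq_pos_of_ne_zero p.ne_zero) hp1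
  refine not_bounded_of_coarselyTame hct ⟨M * R, fun g => ?_⟩
  obtain ⟨z, hz⟩ : ∃ z, z = (g₀⁻¹ * g) • UpperHalfPlane.I := ⟨_, rfl⟩
  have hsec : z.toSL2R = uMat z.re * dMat (log z.im) := by
    have h1 : exp (log z.im * 2⁻¹) = √z.im := by
      rw [← div_eq_mul_inv, exp_half, exp_log z.im_pos]
    apply ext_entry <;> simp only [mul_entry] <;>
      simp [UpperHalfPlane.coe_toSL2R, Real.exp_neg, h1, div_eq_mul_inv]
  obtain ⟨n, hn⟩ := hR z.im z.im_pos
  obtain ⟨γ, hγ, h⟩ := hM (g₀ * uMat z.re * diagMat (p ^ (-n)))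
    (hp (-n) _ (hC.mul_uMat _ _ hg₀))
  refine ⟨γ, hγ, ?_⟩
  have hcancel : diagMat (p ^ (-n)) * diagMat (p ^ n) = 1 := by
    rw [← diagMat_mul, ← _root_.zpow_add, neg_add_cancel, zpow_zero]; apply ext_entry <;> simp
  have e1 : frob (γ * g) = frob (γ * g₀ * z.toSL2R) := by
    rw [← two_cosh_dist, ← two_cosh_dist, mul_smul (γ * g₀), UpperHalfPlane.toSL2R_smul_I, hz,
      smul_smul]
    rw [show γ * g₀ * (g₀⁻¹ * g) = γ * g by group]
  have e2 : γ * g₀ * z.toSL2R = γ * (g₀ * uMat z.re * diagMat (p ^ (-n))) *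
      (diagMat (p ^ n) * dMat (log z.im)) := by
    calc _ = γ * g₀ * uMat z.re * 1 * dMat (log z.im) := by rw [hsec]; group
      _ = _ := by rw [← hcancel]; simp only [mul_assoc]
  have e3 : frob (diagMat (p ^ n) * dMat (log z.im)) ≤ R := by
    rw [frob_diagMat_mul_dMat, exp_log z.im_pos]
    have : ((p ^ n : ℝˣ) : ℝ) ^ 2 = ((p : ℝ) ^ 2) ^ n := by
      rw [Units.val_zpow_eq_zpow_val, ← zpow_natCast, ← zpow_natCast, zpow_comm]
    rwa [this]
  rw [e1, e2]
  exact (frob_mul_le _ _).trans (mul_le_mul h e3 (frob_nonneg _) ((frob_nonneg _).trans h))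

/-- The positive half of each horocycle that returns to a compact region is dense in a minimal
set. -/
theorem subset_closure_of_returns (hC : IsHorocycleMinimal Γ C) {x : SL(2, ℝ)} (hx : x ∈ C)
    (hr : Returns Γ x) (S : ℝ) :
    C ⊆ closure {y | ∃ γ ∈ Γ, ∃ s ≥ S, y = γ * (x * uMat s)} := by
  obtain ⟨M, hM⟩ := hr
  obtain ⟨F, hF⟩ : ∃ F : ℝ → Set SL(2, ℝ),
      ∀ S, F S = {y | ∃ γ ∈ Γ, ∃ s ≥ S, y = γ * (x * uMat s)} := ⟨_, fun S => rfl⟩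
  have hFC : ∀ S, closure (F S) ⊆ C := fun S => closure_minimal (by
    rw [hF]
    rintro _ ⟨γ, hγ, s, -, rfl⟩
    exact hC.mul_left γ hγ _ (hC.mul_uMat s x hx)) hC.isClosed
  have hsub : C ⊆ ⋂ S, closure (F S) := by
    refine hC.minimal _ ((Set.iInter_subset _ 0).trans (hFC 0)) ?_
      (isClosed_iInter fun S => isClosed_closure) ?_ ?_
    · choose s hs γ hγ hM using fun n : ℕ => hM n
      obtain ⟨y, -, hy⟩ := (isCompact_frob_le M).exists_mapClusterPt_of_frequently
        (l := atTop) (f := fun n => γ n * (x * uMat (s n))) (Frequently.of_forall hM)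
      refine ⟨y, Set.mem_iInter.2 fun S => isClosed_closure.mem_of_mapClusterPt hy ?_⟩
      filter_upwards [tendsto_natCast_atTop_atTop.eventually_ge_atTop S] with n hn
      refine subset_closure ?_
      rw [hF]
      exact ⟨γ n, hγ n, s n, hn.trans (hs n), rfl⟩
    · intro δ hδ y hy
      refine Set.mem_iInter.2 fun S => ?_
      refine map_mem_closure (continuous_const_mul δ) (Set.mem_iInter.1 hy S) ?_
      rw [hF]
      rintro _ ⟨γ, hγ, s, hs, rfl⟩
      exact ⟨δ * γ, mul_mem hδ hγ, s, hs, by group⟩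
    · intro r y hy
      refine Set.mem_iInter.2 fun S => ?_
      refine map_mem_closure (f := fun y => y * uMat r) (continuous_mul_const _)
        (Set.mem_iInter.1 hy (S - r)) ?_
      rw [hF, hF]
      rintro _ ⟨γ, hγ, s, hs, rfl⟩
      exact ⟨γ, hγ, s + r, by linarith, by rw [← uMat_mul]; group⟩
  rw [← hF]
  exact hsub.trans (Set.iInter_subset _ S)

/-- If all positive half-horocycles in a minimal set return to compact regions, then the minimal
set is bounded modulo `Γ`. -/
theorem bounded_of_returns (hC : IsHorocycleMinimal Γ C) (hr : ∀ x ∈ C, Returns Γ x) :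
    ∃ M : ℝ, ∀ x ∈ C, ∃ γ ∈ Γ, frob (γ * x) ≤ M := by
  obtain ⟨g, hg⟩ := hC.nonempty
  obtain ⟨M₀, hM₀⟩ : ∃ M₀, frob g < M₀ := exists_gt _
  have hM₀0 : 0 ≤ M₀ := (frob_nonneg g).trans hM₀.le
  have hopen : ∀ (γ : SL(2, ℝ)) (s : ℝ), IsOpen {x | frob (γ * (x * uMat s)) < M₀} :=
    fun γ s => isOpen_lt (continuous_frob.comp
      ((continuous_const_mul γ).comp (continuous_mul_const (uMat s)))) continuous_const
  have hret : ∀ x ∈ C, ∃ γ ∈ Γ, ∃ s ≥ (1 : ℝ), frob (γ * (x * uMat s)) < M₀ := by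
    intro x hx
    have h1 := hC.subset_closure_of_returns hx (hr x hx) 1 hg
    obtain ⟨y, hy, γ, hγ, s, hs, rfl⟩ := mem_closure_iff.1 h1 {x | frob x < M₀}
      (isOpen_lt continuous_frob continuous_const) hM₀
    exact ⟨γ, hγ, s, hs, hy⟩
  have hQ : IsCompact (C ∩ {x | frob x ≤ M₀}) := (isCompact_frob_le M₀).inter_left hC.isClosed
  obtain ⟨R, hR⟩ : ∃ R : ℝ, ∀ x ∈ C ∩ {x | frob x ≤ M₀},
      ∃ γ ∈ Γ, ∃ s ≥ (1 : ℝ), s ≤ R ∧ frob (γ * (x * uMat s)) < M₀ := by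
    refine hQ.induction_on (p := fun A => ∃ R : ℝ, ∀ x ∈ A,
      ∃ γ ∈ Γ, ∃ s ≥ (1 : ℝ), s ≤ R ∧ frob (γ * (x * uMat s)) < M₀) ?_ ?_ ?_ ?_
    · exact ⟨0, fun x hx => hx.elim⟩
    · rintro A B hAB ⟨R, hR⟩
      exact ⟨R, fun x hx => hR x (hAB hx)⟩
    · rintro A B ⟨R, hR⟩ ⟨R', hR'⟩
      refine ⟨max R R', fun x hx => ?_⟩
      rcases hx with hx | hx
      · obtain ⟨γ, hγ, s, hs, hsR, h⟩ := hR x hx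
        exact ⟨γ, hγ, s, hs, hsR.trans (le_max_left _ _), h⟩
      · obtain ⟨γ, hγ, s, hs, hsR, h⟩ := hR' x hx
        exact ⟨γ, hγ, s, hs, hsR.trans (le_max_right _ _), h⟩
    · intro x hx
      obtain ⟨γ, hγ, s, hs, h⟩ := hret x hx.1
      exact ⟨_, mem_nhdsWithin_of_mem_nhds ((hopen γ s).mem_nhds h), s,
        fun y hy => ⟨γ, hγ, s, hs, le_rfl, hy⟩⟩
  have hhalf : ∀ n : ℕ, ∀ x ∈ C ∩ {x | frob x ≤ M₀}, ∀ s : ℝ, 0 ≤ s → s ≤ n →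
      ∃ γ ∈ Γ, frob (γ * (x * uMat s)) ≤ M₀ * (2 + R ^ 2) := by
    have hsmall : ∀ x ∈ C ∩ {x | frob x ≤ M₀}, ∀ s : ℝ, 0 ≤ s → s ≤ R →
        ∃ γ ∈ Γ, frob (γ * (x * uMat s)) ≤ M₀ * (2 + R ^ 2) := by
      intro x hx s hs hsR
      refine ⟨1, one_mem _, ?_⟩
      rw [one_mul]
      refine (frob_mul_le _ _).trans (mul_le_mul hx.2 ?_ (frob_nonneg _) hM₀0)
      rw [frob_uMat]
      gcongr
    intro n
    induction n with
    | zero =>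
      intro x hx s hs hsn
      obtain ⟨_, _, r, hr, hrR, _⟩ := hR x hx
      refine hsmall x hx s hs ?_
      push_cast at hsn
      linarith
    | succ n ih =>
      intro x hx s hs hsn
      rcases le_total s R with hsR | hsR
      · exact hsmall x hx s hs hsR
      · obtain ⟨γ, hγ, r, hr, hrR, h⟩ := hR x hx
        push_cast at hsn
        obtain ⟨δ, hδ, h'⟩ := ih (γ * (x * uMat r))
          ⟨hC.mul_left γ hγ _ (hC.mul_uMat r x hx.1), h.le⟩ (s - r) (by linarith) (by linarith)
        refine ⟨δ * γ, mul_mem hδ hγ, ?_⟩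
        have : δ * γ * (x * uMat s) = δ * (γ * (x * uMat r) * uMat (s - r)) := by
          rw [show s = r + (s - r) by ring, ← uMat_mul]; simp only [mul_assoc]; simp
        rwa [this]
  refine ⟨M₀ * (2 + R ^ 2) * 3, fun y hy => ?_⟩
  obtain ⟨W, hW, hWlt⟩ := exists_nhds_frob_inv_mul_lt y (show (2 : ℝ) < 3 by norm_num)
  obtain ⟨z, hz, γ, hγ, s, hs, rfl⟩ :=
    mem_closure_iff_nhds.1 (hC.subset_closure_of_returns hg (hr g hg) 0 hy) W hW
  obtain ⟨n, hn⟩ := exists_nat_ge s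
  obtain ⟨δ, hδ, h⟩ := hhalf n g ⟨hg, hM₀.le⟩ s hs hn
  refine ⟨δ * γ⁻¹, mul_mem hδ (inv_mem hγ), ?_⟩
  have e : δ * γ⁻¹ * y = δ * (g * uMat s) * ((γ * (g * uMat s))⁻¹ * y) := by group
  rw [e]
  exact (frob_mul_le _ _).trans (mul_le_mul h (hWlt _ hz _ (mem_of_mem_nhds hW)).le
    (frob_nonneg _) (by positivity))

end IsHorocycleMinimal

theorem not_isHorocycleMinimal {Γ : Subgroup SL(2, ℝ)} {a : ℝ} (ha : 0 < a)
    (hbg : BoundedGeomBelow Γ a) (hct : CoarselyTame Γ) (C : Set SL(2, ℝ)) :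
    ¬ IsHorocycleMinimal Γ C := fun hC =>
  hC.not_bounded ha hbg hct
    (hC.bounded_of_returns fun x _ => returns_of_coarselyTame ha hbg hct x)

end HorocycleFlow

/-- **Matsumoto's theorem.** If `Γ` has bounded geometry below some `a > 0`
and `Γ\ℍ` is coarsely tame, then the horocycle flow on `Γ\SL(2,ℝ)` admits no minimal set:
every nonempty closed subset of `SL(2,ℝ)` which is left `Γ`-invariant and right `U`-invariant
properly contains a nonempty closed subset with the same invariance properties. -/
theorem no_minimal_set_for_horocycle_flow (Γ : Subgroup SL(2, ℝ)) (a : ℝ) (ha : 0 < a)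
    (hbg : BoundedGeomBelow Γ a) (hct : CoarselyTame Γ)
    (C : Set SL(2, ℝ)) (hne : C.Nonempty) (hcl : IsClosed C)
    (hΓinv : ∀ γ ∈ Γ, (fun x => γ * x) '' C = C)
    (hUinv : ∀ s : ℝ, (fun x => x * uMat s) '' C = C) :
    ∃ C' : Set SL(2, ℝ), C' ⊂ C ∧ C'.Nonempty ∧ IsClosed C' ∧
      (∀ γ ∈ Γ, (fun x => γ * x) '' C' = C') ∧
      (∀ s : ℝ, (fun x => x * uMat s) '' C' = C') := by
  by_contra! hno
  refine HorocycleFlow.not_isHorocycleMinimal ha hbg hct C ⟨hne, hcl, ?_, ?_, ?_⟩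
  · intro γ hγ x hx
    rw [← hΓinv γ hγ]
    exact ⟨x, hx, rfl⟩
  · intro s x hx
    rw [← hUinv s]
    exact ⟨x, hx, rfl⟩
  · intro P hPC hPne hPcl hPΓ hPU
    by_contra hCP
    obtain ⟨s, hs⟩ := hno P ⟨hPC, hCP⟩ hPne hPcl fun γ hγ => by
      refine Set.Subset.antisymm (Set.image_subset_iff.2 (hPΓ γ hγ)) fun x hx => ?_
      exact ⟨γ⁻¹ * x, hPΓ _ (inv_mem hγ) x hx, mul_inv_cancel_left γ x⟩
    refine hs (Set.Subset.antisymm (Set.image_subset_iff.2 (hPU s)) fun x hx => ?_)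
    refine ⟨x * uMat (-s), hPU (-s) x hx, ?_⟩
    show x * uMat (-s) * uMat s = x
    rw [mul_assoc, HorocycleFlow.uMat_mul, neg_add_cancel, HorocycleFlow.uMat_zero, mul_one]
end
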